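/- arXiv:2312.17497 — 2 statements merged into one kernel-verified Lean document; each statement's English description precedes it below -/
import Mathlib

section
/- Let b > 3/2 and 0 ≤ a ≤ 1. Then for every f ∈ H^a(S¹,ℝ^d) and every orientation-preserving Sobolev diffeomorphism φ ∈ D^b(S¹) the composition satisfies ‖f ∘ φ‖_{Ḣ^a} ≤ ‖(φ^{-1})_θ‖_{L^∞}^{(1−a)/2} ‖φ_θ‖_{L^∞}^{a/2} ‖f‖_{Ḣ^a}. -/
open MeasureTheory intervalIntegral
open scoped BigOperators ENNReal RealInnerProductSpace

noncomputable section

/-- Euclidean space `ℝ^d`. -/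
abbrev Edim (d : ℕ) := EuclideanSpace ℝ (Fin d)

/-- `n`-th Fourier coefficient of a (1-periodic) function `f : ℝ → ℝ`,
identifying `S¹ = ℝ/ℤ`. -/
def fCoeff (f : ℝ → ℝ) (n : ℤ) : ℂ :=
  ∫ θ in (0:ℝ)..1,
    Complex.exp (-2 * (Real.pi : ℂ) * Complex.I * (n : ℂ) * (θ : ℂ)) * (f θ : ℂ)

/-- Squared norm `|f̂(n)|²` of the `n`-th Fourier coefficient of `f : S¹ → ℝ^d`. -/
def coeffNormSq {d : ℕ} (f : ℝ → Edim d) (n : ℤ) : ℝ :=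
  ∑ i : Fin d, ‖fCoeff (fun θ => f θ i) n‖ ^ 2

/-- Homogeneous Sobolev seminorm squared `‖f‖²_{Ḣ^q} = Σ |n|^{2q} |f̂(n)|²`. -/
def homSobSq {d : ℕ} (q : ℝ) (f : ℝ → Edim d) : ℝ :=
  ∑' n : ℤ, |(n : ℝ)| ^ (2 * q) * coeffNormSq f n

/-- Homogeneous Sobolev seminorm `‖f‖_{Ḣ^q}`. -/
def homSobNorm {d : ℕ} (q : ℝ) (f : ℝ → Edim d) : ℝ := Real.sqrt (homSobSq q f)

/-- Full Sobolev norm squared `‖f‖²_{H^q} = Σ (1+n²)^q |f̂(n)|²`. -/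
def sobSq {d : ℕ} (q : ℝ) (f : ℝ → Edim d) : ℝ :=
  ∑' n : ℤ, (1 + (n : ℝ) ^ 2) ^ q * coeffNormSq f n

/-- Full Sobolev norm `‖f‖_{H^q}`. -/
def sobNorm {d : ℕ} (q : ℝ) (f : ℝ → Edim d) : ℝ := Real.sqrt (sobSq q f)

/-- Membership in the Sobolev space `H^q(S¹, ℝ^d)`, viewed as 1-periodic
functions on `ℝ`: periodic, integrable on a period and with finite `H^q`-norm. -/
def InH {d : ℕ} (q : ℝ) (f : ℝ → Edim d) : Prop :=
  Function.Periodic f 1 ∧ IntegrableOn f (Set.Ioc (0:ℝ) 1) ∧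
    Summable (fun n : ℤ => (1 + (n : ℝ) ^ 2) ^ q * coeffNormSq f n)

/-- A tangent vector along a curve of class `H^r`, `r > 3/2`: a continuous
1-periodic function of class `H^r` (with values in the vector space `ℝ^d`). -/
def TangentH {d : ℕ} (r : ℝ) (h : ℝ → Edim d) : Prop :=
  Continuous h ∧ InH r h

/-- Scalar version: homogeneous Sobolev seminorm squared of `f : S¹ → ℝ`. -/
def homSobSq₁ (q : ℝ) (f : ℝ → ℝ) : ℝ :=
  ∑' n : ℤ, |(n : ℝ)| ^ (2 * q) * ‖fCoeff f n‖ ^ 2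

/-- Scalar version: full Sobolev norm squared of `f : S¹ → ℝ`. -/
def sobSq₁ (q : ℝ) (f : ℝ → ℝ) : ℝ :=
  ∑' n : ℤ, (1 + (n : ℝ) ^ 2) ^ q * ‖fCoeff f n‖ ^ 2

/-- Scalar version: membership in `H^q(S¹, ℝ)`. -/
def InH₁ (q : ℝ) (f : ℝ → ℝ) : Prop :=
  Function.Periodic f 1 ∧ IntegrableOn f (Set.Ioc (0:ℝ) 1) ∧
    Summable (fun n : ℤ => (1 + (n : ℝ) ^ 2) ^ q * ‖fCoeff f n‖ ^ 2)

/-- The length `l_c = ∫_{S¹} |c_θ| dθ` of a curve. -/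
def curveLen {d : ℕ} (c : ℝ → Edim d) : ℝ := ∫ θ in (0:ℝ)..1, ‖deriv c θ‖

/-- The constant-speed reparametrization `ψ_c(θ) = l_c⁻¹ ∫_0^θ |c_θ(σ)| dσ`. -/
def psi {d : ℕ} (c : ℝ → Edim d) (θ : ℝ) : ℝ :=
  (curveLen c)⁻¹ * ∫ σ in (0:ℝ)..θ, ‖deriv c σ‖

/-- The inverse `ψ_c⁻¹` of the constant-speed reparametrization. -/
def psiInv {d : ℕ} (c : ℝ → Edim d) : ℝ → ℝ := Function.invFun (psi c)

/-- Squared `L²(S¹)`-norm. -/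
def L2Sq {d : ℕ} (f : ℝ → Edim d) : ℝ := ∫ θ in (0:ℝ)..1, ‖f θ‖ ^ 2

/-- `‖h‖²_{G⁰_c} = l_c ‖h ∘ ψ_c⁻¹‖²_{L²}`. -/
def G0Sq {d : ℕ} (c h : ℝ → Edim d) : ℝ := curveLen c * L2Sq (h ∘ psiInv c)

/-- Homogeneous part `‖h‖²_{Ġ^q_c} = l_c^{1-2q} ‖h ∘ ψ_c⁻¹‖²_{Ḣ^q}`. -/
def GdotSq {d : ℕ} (q : ℝ) (c h : ℝ → Edim d) : ℝ :=
  curveLen c ^ (1 - 2 * q) * homSobSq q (h ∘ psiInv c)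

/-- Homogeneous seminorm `‖h‖_{Ġ^q_c}`. -/
def GdotNorm {d : ℕ} (q : ℝ) (c h : ℝ → Edim d) : ℝ := Real.sqrt (GdotSq q c h)

/-- The reparametrization-invariant Sobolev metric of order `q`:
`‖h‖²_{G^q_c} = l_c ‖h∘ψ_c⁻¹‖²_{L²} + l_c^{1-2q} ‖h∘ψ_c⁻¹‖²_{Ḣ^q}`. -/
def GSq {d : ℕ} (q : ℝ) (c h : ℝ → Edim d) : ℝ := G0Sq c h + GdotSq q c h

/-- The norm `‖h‖_{G^q_c}`. -/
def Gnorm {d : ℕ} (q : ℝ) (c h : ℝ → Edim d) : ℝ := Real.sqrt (GSq q c h)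

/-- The space `Imm(S¹,ℝ^d)` of smooth immersed closed curves. -/
def Imm (d : ℕ) : Set (ℝ → Edim d) :=
  {c | Function.Periodic c 1 ∧ ContDiff ℝ (⊤ : ℕ∞) c ∧ ∀ θ, deriv c θ ≠ 0}

/-- The space `I^r(S¹,ℝ^d)` of Sobolev immersions of class `H^r` (`r > 3/2`). -/
def SobImm (d : ℕ) (r : ℝ) : Set (ℝ → Edim d) :=
  {c | Function.Periodic c 1 ∧ Continuous c ∧
    Summable (fun n : ℤ => (1 + (n : ℝ) ^ 2) ^ r * coeffNormSq c n) ∧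
    ∀ θ, deriv c θ ≠ 0}

/-- Time derivative `∂_t c(t)` of a path of curves. -/
def pathVel {d : ℕ} (p : ℝ → ℝ → Edim d) (t : ℝ) : ℝ → Edim d :=
  fun θ => deriv (fun s => p s θ) t

/-- `G^q`-length of a path of curves over the time interval `[a,b]`. -/
def pathLenOn {d : ℕ} (q : ℝ) (p : ℝ → ℝ → Edim d) (a b : ℝ) : ℝ :=
  ∫ t in a..b, Gnorm q (p t) (pathVel p t)

/-- `G^q`-length of a path of curves over `[0,1]`. -/
def pathLen {d : ℕ} (q : ℝ) (p : ℝ → ℝ → Edim d) : ℝ := pathLenOn q p 0 1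

/-- Admissible (`C¹` in time) paths in `S` joining `c₀` to `c₁`. -/
def IsPathIn {d : ℕ} (S : Set (ℝ → Edim d)) (c₀ c₁ : ℝ → Edim d)
    (p : ℝ → ℝ → Edim d) : Prop :=
  p 0 = c₀ ∧ p 1 = c₁ ∧ (∀ t ∈ Set.Icc (0:ℝ) 1, p t ∈ S) ∧
    ∀ θ : ℝ, ContDiffOn ℝ 1 (fun t => p t θ) (Set.Icc (0:ℝ) 1)

/-- Geodesic distance of the metric `G^q` on the space `S` of curves:
the infimum of the `G^q`-lengths of admissible paths joining `c₀` to `c₁`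
(`∞` if there is no such path). -/
def geodDist {d : ℕ} (q : ℝ) (S : Set (ℝ → Edim d)) (c₀ c₁ : ℝ → Edim d) : ℝ≥0∞ :=
  ⨅ (p : ℝ → ℝ → Edim d) (_ : IsPathIn S c₀ c₁ p), ENNReal.ofReal (pathLen q p)

/-- The metric ball of radius `ρ` around `c₀` for the geodesic distance of `G^r`
on `I^r(S¹,ℝ^d)`. -/
def GBall {d : ℕ} (r : ℝ) (c₀ : ℝ → Edim d) (ρ : ℝ) : Set (ℝ → Edim d) :=
  {c | c ∈ SobImm d r ∧ geodDist r (SobImm d r) c₀ c < ENNReal.ofReal ρ}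

/-- A geodesic of `(S, G^q)` on the time interval `I`: a constant-speed path in
`S` that is locally length-minimizing. -/
def IsGeodesicOn {d : ℕ} (q : ℝ) (S : Set (ℝ → Edim d)) (p : ℝ → ℝ → Edim d)
    (I : Set ℝ) : Prop :=
  (∀ t ∈ I, p t ∈ S) ∧
  (∀ θ : ℝ, ContDiffOn ℝ 1 (fun t => p t θ) I) ∧
  (∃ v : ℝ, ∀ t ∈ I, Gnorm q (p t) (pathVel p t) = v) ∧
  ∀ t ∈ I, ∃ ε > 0, ∀ a ∈ I, ∀ b ∈ I, t - ε ≤ a → a ≤ b → b ≤ t + ε →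
    ENNReal.ofReal (pathLenOn q p a b) = geodDist q S (p a) (p b)


/-- An orientation-preserving Sobolev diffeomorphism of `S¹` of class `H^b`:
a `C¹` map `φ : ℝ → ℝ` with `φ(θ+1) = φ(θ)+1`, `φ' > 0`, and `φ - id` of
Sobolev class `H^b`. -/
def IsSobDiffeo (b : ℝ) (φ : ℝ → ℝ) : Prop :=
  ContDiff ℝ 1 φ ∧ (∀ θ, φ (θ + 1) = φ θ + 1) ∧ (∀ θ, 0 < deriv φ θ) ∧
    InH₁ b (fun θ => φ θ - θ)

/-- The character `exp(2πi n x)`. -/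
def ee (n : ℤ) (x : ℝ) : ℂ := Complex.exp (2 * (Real.pi : ℂ) * Complex.I * (n : ℂ) * (x : ℂ))

/-- Fourier coefficient of a complex function on `[0,1]`. -/
def cC (u : ℝ → ℂ) (m : ℤ) : ℂ := ∫ θ in (0:ℝ)..1, ee (-m) θ * u θ

lemma ee_cont (n : ℤ) : Continuous (ee n) := by
  unfold ee; fun_prop

lemma ee_eq_fourier (n : ℤ) (x : ℝ) : ee n x = fourier n (x : AddCircle (1:ℝ)) := by
  rw [fourier_coe_apply]; simp [ee]

lemma ee_periodic (n : ℤ) (x : ℝ) : ee n (x + 1) = ee n x := by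
  rw [ee_eq_fourier, ee_eq_fourier]; simp

lemma ee_norm (n : ℤ) (x : ℝ) : ‖ee n x‖ = 1 := by
  rw [ee_eq_fourier]; exact Circle.norm_coe _

lemma ee_hasDerivAt (n : ℤ) (x : ℝ) :
    HasDerivAt (ee n) (2 * Real.pi * Complex.I * n * ee n x) x := by
  have := hasDerivAt_fourier 1 n x
  simp only [← ee_eq_fourier] at this
  simpa using this

lemma fCoeff_eq (f : ℝ → ℝ) (n : ℤ) : fCoeff f n = cC (fun θ => (f θ : ℂ)) n := by
  unfold fCoeff cC ee
  congr 1; ext θ; congr 2; push_cast; ring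

lemma cC_eq_fourierCoeffOn (u : ℝ → ℂ) (n : ℤ) :
    cC u n = fourierCoeffOn (zero_lt_one' ℝ) u n := by
  rw [fourierCoeffOn_eq_integral, cC]
  simp only [fourier_coe_apply, ee]
  simp

lemma parseval (u : ℝ → ℂ) (hu : Continuous u) :
    HasSum (fun n => ‖cC u n‖ ^ 2) (∫ θ in (0:ℝ)..1, ‖u θ‖ ^ 2) := by
  have hm : MemLp u 2 (volume.restrict (Set.Ioc (0:ℝ) 1)) := by
    rw [memLp_two_iff_integrable_sq_norm hu.aestronglyMeasurable]
    have h2 : Continuous fun x => ‖u x‖ ^ 2 := by fun_prop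
    exact h2.integrableOn_Ioc
  have := hasSum_sq_fourierCoeffOn (zero_lt_one' ℝ) hm
  simpa [cC_eq_fourierCoeffOn] using this

lemma bessel (u : ℝ → ℂ) (hu : Continuous u) (R : Finset ℤ) :
    ∑ m ∈ R, ‖cC u m‖ ^ 2 ≤ ∫ θ in (0:ℝ)..1, ‖u θ‖ ^ 2 :=
  sum_le_hasSum R (fun _ _ => by positivity) (parseval u hu)

lemma cC_sum (S : Finset ℤ) (c : ℤ → ℂ) (v : ℤ → ℝ → ℂ) (hv : ∀ n, Continuous (v n)) (m : ℤ) :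
    cC (fun θ => ∑ n ∈ S, c n * v n θ) m = ∑ n ∈ S, cC (v n) m * c n := by
  unfold cC
  simp only [Finset.mul_sum]
  rw [intervalIntegral.integral_finsetSum]
  · refine Finset.sum_congr rfl fun n _ => ?_
    rw [← intervalIntegral.integral_mul_const]
    congr 1; ext θ; ring
  · intro n _
    have := ee_cont (-m)
    have := hv n
    exact Continuous.intervalIntegrable (by fun_prop) _ _

lemma cC_ee (n m : ℤ) : cC (ee n) m = if m = n then 1 else 0 := by
  have h := congrFun (fourierCoeff_fourier (T := 1) n) m
  rw [fourierCoeff_eq_intervalIntegral _ _ 0] at h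
  simp only [← ee_eq_fourier] at h
  rw [cC]
  simp only [one_div, inv_one, one_smul, zero_add, smul_eq_mul] at h
  rw [h, Pi.single_apply]

lemma trig_norm (S : Finset ℤ) (c : ℤ → ℂ) :
    ∫ θ in (0:ℝ)..1, ‖∑ n ∈ S, c n * ee n θ‖ ^ 2 = ∑ n ∈ S, ‖c n‖ ^ 2 := by
  have hc : Continuous fun θ => ∑ n ∈ S, c n * ee n θ := by
    have := ee_cont
    fun_prop
  have h := parseval _ hc
  refine h.unique ?_
  have : ∀ m, cC (fun θ => ∑ n ∈ S, c n * ee n θ) m = if m ∈ S then c m else 0 := by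
    intro m
    rw [cC_sum _ _ _ ee_cont]
    simp [cC_ee]
  simp only [this]
  have h2 : HasSum (fun m => ‖if m ∈ S then c m else 0‖ ^ 2)
      (∑ m ∈ S, ‖if m ∈ S then c m else 0‖ ^ 2) :=
    hasSum_sum_of_ne_finset_zero (fun b hb => by simp [hb])
  rwa [Finset.sum_congr rfl fun n hn => by rw [if_pos hn]] at h2

lemma cC_deriv (u u' : ℝ → ℂ) (h : ∀ x, HasDerivAt u (u' x) x) (hu' : Continuous u')
    (hp : u 1 = u 0) (m : ℤ) :
    cC u' m = 2 * Real.pi * Complex.I * m * cC u m := by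
  have h1 : ∀ x ∈ Set.uIcc (0:ℝ) 1, HasDerivAt (ee (-m))
      (2 * Real.pi * Complex.I * (-m : ℤ) * ee (-m) x) x := fun x _ => ee_hasDerivAt _ x
  have := intervalIntegral.integral_mul_deriv_eq_deriv_mul h1 (fun x _ => h x)
    (by have := ee_cont (-m); exact Continuous.intervalIntegrable (by fun_prop) _ _)
    (hu'.intervalIntegrable _ _)
  have e : ee (-m) 1 = ee (-m) 0 := by simpa using ee_periodic (-m) 0
  rw [e, hp, sub_self, zero_sub] at this
  rw [cC, this, cC, ← intervalIntegral.integral_const_mul, ← intervalIntegral.integral_neg]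
  congr 1; ext x; push_cast; ring

/-- For `F ∈ L¹` with square-summable coefficients, Parseval against continuous functions. -/
lemma key_circle (F : AddCircle (1:ℝ) → ℂ) (hF : Integrable F AddCircle.haarAddCircle)
    (hs : Summable fun n => ‖fourierCoeff F n‖ ^ 2) (g : C(AddCircle (1:ℝ), ℂ)) :
    HasSum (fun n : ℤ => (∫ t, fourier n t * g t ∂AddCircle.haarAddCircle) * fourierCoeff F n)
      (∫ t, F t * g t ∂AddCircle.haarAddCircle) := by
  let μ : Measure (AddCircle (1:ℝ)) := AddCircle.haarAddCircle
  have hmem : Memℓp (fun n => fourierCoeff F n) 2 := by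
    apply memℓp_gen
    simpa using hs
  let c : lp (fun _ : ℤ => ℂ) 2 := ⟨fun n => fourierCoeff F n, hmem⟩
  let F2 : Lp ℂ 2 μ := fourierBasis.repr.symm c
  have hF2 : ∀ n, fourierCoeff F2 n = fourierCoeff F n := by
    intro n
    rw [← fourierBasis_repr]
    simp [F2, c]
  have hF2i : Integrable F2 μ := (Lp.memLp F2).integrable (by norm_num)
  -- the difference annihilates continuous functions
  have hb : ∀ (G : AddCircle (1:ℝ) → ℂ), Integrable G μ → ∀ h : C(AddCircle (1:ℝ), ℂ),
      Integrable (fun t => G t * h t) μ := by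
    intro G hG h
    refine hG.mul_bdd (c := ‖h‖) h.continuous.aestronglyMeasurable ?_
    exact Filter.Eventually.of_forall fun t => h.norm_coe_le_norm t
  let D : AddCircle (1:ℝ) → ℂ := fun t => F t - F2 t
  have hD : Integrable D μ := hF.sub hF2i
  let L : C(AddCircle (1:ℝ), ℂ) →ₗ[ℂ] ℂ :=
    { toFun := fun h => ∫ t, D t * h t ∂μ
      map_add' := by
        intro h k
        rw [← integral_add (hb D hD h) (hb D hD k)]
        congr 1; ext t; simp [mul_add]
      map_smul' := by
        intro a h
        simp only [RingHom.id_apply, smul_eq_mul]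
        rw [← MeasureTheory.integral_const_mul]
        congr 1; ext t; simp; ring }
  let L' : C(AddCircle (1:ℝ), ℂ) →L[ℂ] ℂ := L.mkContinuous (∫ t, ‖D t‖ ∂μ) (by
    intro h
    change ‖∫ t, D t * h t ∂μ‖ ≤ _
    rw [← MeasureTheory.integral_mul_const]
    refine norm_integral_le_of_norm_le (hD.norm.mul_const _) ?_
    refine Filter.Eventually.of_forall fun t => ?_
    rw [norm_mul]
    exact mul_le_mul_of_nonneg_left (h.norm_coe_le_norm t) (norm_nonneg _))
  have hker : ∀ h, L' h = 0 := by
    have : (Submodule.span ℂ (Set.range (@fourier (1:ℝ)))).topologicalClosure ≤ LinearMap.ker (L' : C(AddCircle (1:ℝ), ℂ) →ₗ[ℂ] ℂ) := by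
      refine Submodule.topologicalClosure_minimal _ ?_ L'.isClosed_ker
      rw [Submodule.span_le]
      rintro _ ⟨n, rfl⟩
      change ∫ t, D t * fourier n t ∂μ = 0
      have h1 := hF2 (-n)
      unfold fourierCoeff at h1
      simp only [neg_neg, smul_eq_mul] at h1
      simp only [D, sub_mul]
      rw [integral_sub (hb F hF _) (hb F2 hF2i _), sub_eq_zero]
      simp only [mul_comm _ (fourier n _)]
      exact h1.symm
    rw [span_fourier_closure_eq_top] at this
    intro h
    exact this (Submodule.mem_top (x := h))
  have hFg : ∫ t, F t * g t ∂μ = ∫ t, F2 t * g t ∂μ := by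
    have := hker g
    change ∫ t, (F t - F2 t) * g t ∂μ = 0 at this
    simp only [sub_mul] at this
    rwa [integral_sub (hb F hF _) (hb F2 hF2i _), sub_eq_zero] at this
  change HasSum _ (∫ t, F t * g t ∂μ)
  rw [hFg]
  let gs : Lp ℂ 2 μ := ContinuousMap.toLp (E := ℂ) 2 μ ℂ (star g)
  have hgs : gs =ᵐ[μ] (star g : C(AddCircle (1:ℝ), ℂ)) := ContinuousMap.coeFn_toLp μ (star g)
  have H := fourierBasis.hasSum_inner_mul_inner gs F2
  have e1 : (fun n : ℤ => (∫ t, fourier n t * g t ∂AddCircle.haarAddCircle) * fourierCoeff F n) =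
      fun i => inner ℂ gs (fourierBasis i) * inner ℂ (fourierBasis i) F2 := by
    ext1 n
    rw [← fourierBasis.repr_apply_apply F2 n, fourierBasis_repr, hF2]
    congr 1
    rw [MeasureTheory.L2.inner_def, coe_fourierBasis]
    refine integral_congr_ae ?_
    filter_upwards [hgs, coeFn_fourierLp 2 n] with t h1 h2
    rw [h1, h2]
    simp [-fourier_apply]
  have e2 : ∫ t, F2 t * g t ∂μ = inner ℂ gs F2 := by
    rw [MeasureTheory.L2.inner_def]
    refine integral_congr_ae ?_
    filter_upwards [hgs] with t h1
    rw [h1]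
    simp
  rw [e1, e2]
  exact H

lemma key_real (f : ℝ → ℝ) (hf : IntegrableOn f (Set.Ioc (0:ℝ) 1))
    (hs : Summable fun n => ‖fCoeff f n‖ ^ 2) (h : ℝ → ℂ) (hc : Continuous h)
    (hp : Function.Periodic h 1) :
    HasSum (fun n : ℤ => (∫ x in (0:ℝ)..1, ee n x * h x) * fCoeff f n)
      (∫ x in (0:ℝ)..1, (f x : ℂ) * h x) := by
  let F : AddCircle (1:ℝ) → ℂ := AddCircle.liftIoc 1 0 (fun x => (f x : ℂ))
  have hμ : (AddCircle.haarAddCircle : Measure (AddCircle (1:ℝ))) = volume := by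
    rw [AddCircle.volume_eq_smul_haarAddCircle]; simp
  let g : C(AddCircle (1:ℝ), ℂ) := ⟨hp.lift, by
    exact continuous_quot_lift _ hc⟩
  have hg : ∀ x : ℝ, g (x : AddCircle (1:ℝ)) = h x := fun x => hp.lift_coe x
  have hF : Integrable F AddCircle.haarAddCircle := by
    rw [hμ]
    have h1 : MemLp (fun x => (f x : ℂ)) 1 (volume.restrict (Set.Ioc (0:ℝ) (0 + 1))) := by
      rw [memLp_one_iff_integrable, zero_add]
      exact hf.ofReal
    exact memLp_one_iff_integrable.1 h1.memLp_liftIoc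
  have hco : ∀ n, fourierCoeff F n = fCoeff f n := by
    intro n
    rw [fCoeff_eq, cC_eq_fourierCoeffOn]
    have := fourierCoeff_liftIoc_eq (T := 1) (a := 0) (fun x => (f x : ℂ)) n
    rw [show fourierCoeff F n = _ from this, fourierCoeffOn_eq_integral, fourierCoeffOn_eq_integral]
    simp
  have key := key_circle F hF (by simpa only [hco] using hs) g
  simp only [hco, hμ] at key
  convert key using 1
  · ext n
    congr 1
    rw [← AddCircle.intervalIntegral_preimage 1 0, zero_add]
    simp only [hg, ← ee_eq_fourier]
  · rw [← AddCircle.intervalIntegral_preimage 1 0, zero_add]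
    simp only [hg]
    rw [intervalIntegral.integral_of_le zero_le_one, intervalIntegral.integral_of_le zero_le_one]
    refine setIntegral_congr_fun measurableSet_Ioc fun x hx => ?_
    have : F (x : AddCircle (1:ℝ)) = f x := by
      exact AddCircle.liftIoc_coe_apply (by simpa using hx)
    simp [this]

/-- Finite-dimensional interpolation between weighted `ℓ²` spaces (three lines theorem). -/
lemma interp (A : ℤ → ℤ → ℂ) (R S : Finset ℤ) (hR : ∀ m ∈ R, m ≠ 0) (hS : ∀ n ∈ S, n ≠ 0)
    (M0 M1 : ℝ) (hM0 : 0 ≤ M0) (hM1 : 0 ≤ M1)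
    (H0 : ∀ x : ℤ → ℂ, ∑ m ∈ R, ‖∑ n ∈ S, A m n * x n‖ ^ 2 ≤ M0 * ∑ n ∈ S, ‖x n‖ ^ 2)
    (H1 : ∀ x : ℤ → ℂ, ∑ m ∈ R, (m:ℝ) ^ 2 * ‖∑ n ∈ S, A m n * x n‖ ^ 2 ≤
      M1 * ∑ n ∈ S, (n:ℝ) ^ 2 * ‖x n‖ ^ 2)
    (a : ℝ) (ha0 : 0 ≤ a) (ha1 : a ≤ 1) (x : ℤ → ℂ) :
    ∑ m ∈ R, |(m:ℝ)| ^ (2 * a) * ‖∑ n ∈ S, A m n * x n‖ ^ 2 ≤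
      M0 ^ (1 - a) * M1 ^ a * ∑ n ∈ S, |(n:ℝ)| ^ (2 * a) * ‖x n‖ ^ 2 := by
  set q : ℤ → ℂ := fun m => ∑ n ∈ S, A m n * x n with hq
  set Q : ℝ := ∑ m ∈ R, |(m:ℝ)| ^ (2 * a) * ‖q m‖ ^ 2 with hQ
  set W : ℝ := ∑ n ∈ S, |(n:ℝ)| ^ (2 * a) * ‖x n‖ ^ 2 with hW
  have hQ0 : 0 ≤ Q := Finset.sum_nonneg fun _ _ => by positivity
  have hW0 : 0 ≤ W := Finset.sum_nonneg fun _ _ => by positivity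
  have pos : ∀ n : ℤ, n ≠ 0 → 0 < |(n:ℝ)| := fun n hn => by positivity
  have dbl : ∀ n : ℤ, n ≠ 0 → (|(n:ℝ)| ^ a) ^ 2 = |(n:ℝ)| ^ (2 * a) := fun n hn => by
    rw [← Real.rpow_natCast, ← Real.rpow_mul (abs_nonneg _)]; congr 1; push_cast; ring
  let nm : ℤ → ℂ := fun n => ((|(n:ℝ)| : ℝ) : ℂ)
  have nmne : ∀ n : ℤ, n ≠ 0 → nm n ≠ 0 := fun n hn => by
    simpa [nm] using hn
  have nmn : ∀ n : ℤ, n ≠ 0 → ∀ z : ℂ, ‖nm n ^ z‖ = |(n:ℝ)| ^ z.re := fun n hn z =>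
    Complex.norm_cpow_eq_rpow_re_of_pos (pos n hn) z
  let y : ℤ → ℂ := fun m => nm m ^ (a:ℂ) * star (q m)
  let w : ℤ → ℂ := fun n => nm n ^ (a:ℂ) * x n
  let X : ℂ → ℤ → ℂ := fun z n => nm n ^ (-z) * w n
  let F : ℂ → ℂ := fun z => ∑ m ∈ R, y m * nm m ^ z * ∑ n ∈ S, A m n * (nm n ^ (-z) * w n)
  have hy : ∑ m ∈ R, ‖y m‖ ^ 2 = Q := by
    refine Finset.sum_congr rfl fun m hm => ?_
    simp only [y]
    rw [norm_mul, nmn m (hR m hm), norm_star, mul_pow, Complex.ofReal_re, dbl m (hR m hm)]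
  have hw : ∑ n ∈ S, ‖w n‖ ^ 2 = W := by
    refine Finset.sum_congr rfl fun m hm => ?_
    simp only [w]
    rw [norm_mul, nmn m (hS m hm), mul_pow, Complex.ofReal_re, dbl m (hS m hm)]
  -- Cauchy-Schwarz
  have CS : ∀ z, ‖F z‖ ≤ Real.sqrt Q *
      Real.sqrt (∑ m ∈ R, ‖nm m ^ z * ∑ n ∈ S, A m n * X z n‖ ^ 2) := by
    intro z
    calc ‖F z‖ ≤ ∑ m ∈ R, ‖y m‖ * ‖nm m ^ z * ∑ n ∈ S, A m n * X z n‖ := by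
          refine (norm_sum_le _ _).trans (Finset.sum_le_sum fun m _ => ?_)
          rw [mul_assoc, norm_mul]
      _ ≤ _ := by
          rw [← hy]
          exact Real.sum_mul_le_sqrt_mul_sqrt R _ _
  have b0 : ∀ z ∈ Complex.re ⁻¹' {(0:ℝ)}, ‖F z‖ ≤ Real.sqrt Q * Real.sqrt (M0 * W) := by
    intro z hz
    have hz : z.re = 0 := hz
    refine (CS z).trans (mul_le_mul_of_nonneg_left (Real.sqrt_le_sqrt ?_) (Real.sqrt_nonneg _))
    calc _ = ∑ m ∈ R, ‖∑ n ∈ S, A m n * X z n‖ ^ 2 := by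
          refine Finset.sum_congr rfl fun m hm => ?_
          rw [norm_mul, nmn m (hR m hm), hz, Real.rpow_zero, one_mul]
      _ ≤ M0 * ∑ n ∈ S, ‖X z n‖ ^ 2 := H0 _
      _ = M0 * W := by
          rw [← hw]; congr 1
          refine Finset.sum_congr rfl fun m hm => ?_
          simp only [X]
          rw [norm_mul, nmn m (hS m hm), Complex.neg_re, hz, neg_zero, Real.rpow_zero, one_mul]
  have b1 : ∀ z ∈ Complex.re ⁻¹' {(1:ℝ)}, ‖F z‖ ≤ Real.sqrt Q * Real.sqrt (M1 * W) := by
    intro z hz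
    have hz : z.re = 1 := hz
    refine (CS z).trans (mul_le_mul_of_nonneg_left (Real.sqrt_le_sqrt ?_) (Real.sqrt_nonneg _))
    calc _ = ∑ m ∈ R, (m:ℝ) ^ 2 * ‖∑ n ∈ S, A m n * X z n‖ ^ 2 := by
          refine Finset.sum_congr rfl fun m hm => ?_
          rw [norm_mul, nmn m (hR m hm), hz, Real.rpow_one, mul_pow, sq_abs]
      _ ≤ M1 * ∑ n ∈ S, (n:ℝ) ^ 2 * ‖X z n‖ ^ 2 := H1 _
      _ = M1 * W := by
          rw [← hw]; congr 1
          refine Finset.sum_congr rfl fun m hm => ?_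
          simp only [X]
          have := pos m (hS m hm)
          rw [norm_mul, nmn m (hS m hm), Complex.neg_re, hz, Real.rpow_neg_one, mul_pow, inv_pow,
            sq_abs]
          have : (m:ℝ) ≠ 0 := by exact_mod_cast hS m hm
          field_simp
  have Fd : Differentiable ℂ F := by
    refine Differentiable.fun_sum fun m hm => ?_
    refine Differentiable.mul ?_ ?_
    · refine Differentiable.const_mul ?_ _
      exact Differentiable.const_cpow differentiable_id (Or.inl (nmne m (hR m hm)))
    · refine Differentiable.fun_sum fun n hn => ?_
      refine Differentiable.const_mul ?_ _
      refine Differentiable.mul_const ?_ _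
      exact Differentiable.const_cpow differentiable_id.neg (Or.inl (nmne n (hS n hn)))
  have hbd : BddAbove ((norm ∘ F) '' Complex.HadamardThreeLines.verticalClosedStrip 0 1) := by
    refine ⟨∑ m ∈ R, ‖y m‖ * |(m:ℝ)| * ∑ n ∈ S, ‖A m n‖ * (1 * ‖w n‖), ?_⟩
    rintro _ ⟨z, hz, rfl⟩
    have hz : 0 ≤ z.re ∧ z.re ≤ 1 := hz
    have one_le : ∀ n : ℤ, n ≠ 0 → 1 ≤ |(n:ℝ)| := fun n hn => by
      exact_mod_cast Int.one_le_abs hn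
    refine (norm_sum_le _ _).trans (Finset.sum_le_sum fun m hm => ?_)
    rw [norm_mul, norm_mul, nmn m (hR m hm)]
    have e1 : |(m:ℝ)| ^ z.re ≤ |(m:ℝ)| := by
      simpa using Real.rpow_le_rpow_of_exponent_le (one_le m (hR m hm)) hz.2
    have e2 : ‖∑ n ∈ S, A m n * (nm n ^ (-z) * w n)‖ ≤ ∑ n ∈ S, ‖A m n‖ * (1 * ‖w n‖) := by
      refine (norm_sum_le _ _).trans (Finset.sum_le_sum fun n hn => ?_)
      rw [norm_mul, norm_mul, nmn n (hS n hn)]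
      have : |(n:ℝ)| ^ (-z).re ≤ 1 :=
        Real.rpow_le_one_of_one_le_of_nonpos (one_le n (hS n hn)) (by simpa using hz.1)
      gcongr
    gcongr
  have main := Complex.HadamardThreeLines.norm_le_interp_of_mem_verticalClosedStrip' (f := F)
    (z := (a:ℂ)) (l := 0) (u := 1) zero_lt_one ⟨by simpa using ha0, by simpa using ha1⟩
    Fd.diffContOnCl hbd b0 b1
  have hFa : F a = Q := by
    simp only [F, hQ]
    push_cast
    refine Finset.sum_congr rfl fun m hm => ?_
    have e : ∑ n ∈ S, A m n * (nm n ^ (-(a:ℂ)) * w n) = q m := by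
      refine Finset.sum_congr rfl fun n hn => ?_
      simp only [w]
      rw [← mul_assoc (nm n ^ (-(a:ℂ))), ← Complex.cpow_add _ _ (nmne n (hS n hn))]
      simp
    rw [e]
    simp only [y]
    have e2 : ((|(m:ℝ)| ^ (2 * a) : ℝ) : ℂ) = nm m ^ (a:ℂ) * nm m ^ (a:ℂ) := by
      rw [← Complex.cpow_add _ _ (nmne m (hR m hm)), Complex.ofReal_cpow (abs_nonneg _)]
      congr 1; push_cast; ring
    have e3 : ((‖q m‖:ℝ):ℂ) ^ 2 = star (q m) * q m := by
      rw [← Complex.conj_mul']; rfl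
    rw [e3]
    rw [e2]
    ring
  rw [hFa] at main
  simp only [Complex.ofReal_re, sub_zero, div_one, Complex.norm_real, Real.norm_eq_abs,
    abs_of_nonneg hQ0] at main
  -- square
  have sq : Q ^ 2 ≤ Q * (M0 ^ (1 - a) * M1 ^ a * W) := by
    calc Q ^ 2 ≤ ((Real.sqrt Q * Real.sqrt (M0 * W)) ^ (1 - a) *
          (Real.sqrt Q * Real.sqrt (M1 * W)) ^ a) ^ 2 := by gcongr
      _ = (Q * (M0 * W)) ^ (1 - a) * (Q * (M1 * W)) ^ a := by
        have t : ∀ r s : ℝ, 0 ≤ r → (Real.sqrt Q * Real.sqrt r) ^ s * (Real.sqrt Q * Real.sqrt r) ^ s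
            = (Q * r) ^ s := by
          intro r s hr
          rw [← Real.mul_rpow (by positivity) (by positivity)]
          congr 1
          rw [mul_mul_mul_comm, Real.mul_self_sqrt hQ0, Real.mul_self_sqrt hr]
        rw [← t (M0 * W) _ (by positivity), ← t (M1 * W) _ (by positivity)]
        ring
      _ = (Q ^ (1 - a) * Q ^ a) * (W ^ (1 - a) * W ^ a) * (M0 ^ (1 - a) * M1 ^ a) := by
        rw [Real.mul_rpow hQ0 (by positivity), Real.mul_rpow hM0 hW0,
          Real.mul_rpow hQ0 (by positivity), Real.mul_rpow hM1 hW0]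
        ring
      _ = Q * (M0 ^ (1 - a) * M1 ^ a * W) := by
        have t : ∀ r : ℝ, 0 ≤ r → r ^ (1 - a) * r ^ a = r := by
          intro r hr
          rw [← Real.rpow_add_of_nonneg hr (by linarith) ha0]; simp
        rw [t Q hQ0, t W hW0]; ring
  rcases hQ0.eq_or_lt with h | h
  · rw [← h]; positivity
  · rw [pow_two] at sq
    exact le_of_mul_le_mul_left sq h

lemma phi_hasDerivAt {φ : ℝ → ℝ} (h1 : ContDiff ℝ 1 φ) (θ : ℝ) :
    HasDerivAt φ (deriv φ θ) θ :=
  (h1.differentiable (by norm_num) θ).hasDerivAt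

lemma phi_deriv_cont {φ : ℝ → ℝ} (h1 : ContDiff ℝ 1 φ) : Continuous (deriv φ) :=
  h1.continuous_deriv le_rfl

lemma phi_deriv_per {φ : ℝ → ℝ} (h2 : ∀ θ, φ (θ + 1) = φ θ + 1) :
    Function.Periodic (deriv φ) 1 := by
  intro θ
  rw [← deriv_comp_add_const]
  simp only [h2]
  simp

lemma phi_int {φ : ℝ → ℝ} (h2 : ∀ θ, φ (θ + 1) = φ θ + 1) (n : ℤ) : φ n = φ 0 + n := by
  have hp : Function.Periodic (fun θ => φ θ - θ) 1 := by
    intro θ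
    simp only [h2]; ring
  have := hp.int_mul n 0
  simp at this
  linarith

lemma phi_surj {φ : ℝ → ℝ} (h1 : ContDiff ℝ 1 φ) (h2 : ∀ θ, φ (θ + 1) = φ θ + 1) :
    Function.Surjective φ := by
  intro y
  have a1 := phi_int h2 ⌊y - φ 0⌋
  have a2 := h2 ⌊y - φ 0⌋
  have a3 := Int.floor_le (y - φ 0)
  have a4 := Int.lt_floor_add_one (y - φ 0)
  have hle : (⌊y - φ 0⌋ : ℝ) ≤ ⌊y - φ 0⌋ + 1 := by linarith
  obtain ⟨x, -, hx⟩ := intermediate_value_Icc hle h1.continuous.continuousOn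
    (show y ∈ Set.Icc (φ ⌊y - φ 0⌋) (φ (⌊y - φ 0⌋ + 1)) from
      ⟨by linarith, by linarith⟩)
  exact ⟨x, hx⟩

lemma phi_inv_left {φ : ℝ → ℝ} (h3 : ∀ θ, 0 < deriv φ θ) (θ : ℝ) :
    Function.invFun φ (φ θ) = θ :=
  Function.leftInverse_invFun (strictMono_of_deriv_pos h3).injective θ

lemma phi_inv_right {φ : ℝ → ℝ} (h1 : ContDiff ℝ 1 φ) (h2 : ∀ θ, φ (θ + 1) = φ θ + 1) (y : ℝ) :
    φ (Function.invFun φ y) = y :=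
  Function.rightInverse_invFun (phi_surj h1 h2) y

lemma psi_add_one {φ : ℝ → ℝ} (h1 : ContDiff ℝ 1 φ) (h2 : ∀ θ, φ (θ + 1) = φ θ + 1)
    (h3 : ∀ θ, 0 < deriv φ θ) (y : ℝ) :
    Function.invFun φ (y + 1) = Function.invFun φ y + 1 := by
  apply (strictMono_of_deriv_pos h3).injective
  rw [phi_inv_right h1 h2, h2, phi_inv_right h1 h2]

lemma psi_cont {φ : ℝ → ℝ} (h1 : ContDiff ℝ 1 φ) (h2 : ∀ θ, φ (θ + 1) = φ θ + 1)
    (h3 : ∀ θ, 0 < deriv φ θ) : Continuous (Function.invFun φ) := by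
  have hm := strictMono_of_deriv_pos h3
  have : StrictMono (Function.invFun φ) := by
    intro x y hxy
    rw [← hm.lt_iff_lt, phi_inv_right h1 h2, phi_inv_right h1 h2]
    exact hxy
  exact this.monotone.continuous_of_surjective fun θ => ⟨φ θ, phi_inv_left h3 θ⟩

lemma psi_hasDerivAt {φ : ℝ → ℝ} (h1 : ContDiff ℝ 1 φ) (h2 : ∀ θ, φ (θ + 1) = φ θ + 1)
    (h3 : ∀ θ, 0 < deriv φ θ) (y : ℝ) :
    HasDerivAt (Function.invFun φ) (deriv φ (Function.invFun φ y))⁻¹ y :=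
  HasDerivAt.of_local_left_inverse (psi_cont h1 h2 h3).continuousAt (phi_hasDerivAt h1 _)
    (h3 _).ne' (Filter.Eventually.of_forall fun y => phi_inv_right h1 h2 y)

lemma M1_bound {φ : ℝ → ℝ} (h1 : ContDiff ℝ 1 φ) (h2 : ∀ θ, φ (θ + 1) = φ θ + 1) (θ : ℝ) :
    deriv φ θ ≤ ⨆ θ : ℝ, |deriv φ θ| := by
  have hp : Function.Periodic (fun θ => |deriv φ θ|) 1 := fun θ => by
    simp only [phi_deriv_per h2 θ]
  have hb := (hp.compact_of_continuous one_ne_zero (phi_deriv_cont h1).abs).bddAbove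
  exact (le_abs_self _).trans (le_ciSup hb θ)

lemma M0_bound {φ : ℝ → ℝ} (h1 : ContDiff ℝ 1 φ) (h2 : ∀ θ, φ (θ + 1) = φ θ + 1)
    (h3 : ∀ θ, 0 < deriv φ θ) (θ : ℝ) :
    1 ≤ (⨆ θ : ℝ, |deriv (Function.invFun φ) θ|) * deriv φ θ := by
  have hd : deriv (Function.invFun φ) = fun y => (deriv φ (Function.invFun φ y))⁻¹ := by
    ext y; exact (psi_hasDerivAt h1 h2 h3 y).deriv
  have hp : Function.Periodic (fun θ => |deriv (Function.invFun φ) θ|) 1 := fun θ => by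
    simp only [hd, psi_add_one h1 h2 h3, phi_deriv_per h2 _]
  have hc : Continuous (fun θ => |deriv (Function.invFun φ) θ|) := by
    rw [hd]
    exact (((phi_deriv_cont h1).comp (psi_cont h1 h2 h3)).inv₀ fun y => (h3 _).ne').abs
  have hb := (hp.compact_of_continuous one_ne_zero hc).bddAbove
  have := le_ciSup hb (φ θ)
  rw [show |deriv (Function.invFun φ) (φ θ)| = (deriv φ θ)⁻¹ by
    rw [hd]; simp only [phi_inv_left h3]; exact abs_of_pos (inv_pos.2 (h3 θ))] at this
  rwa [inv_le_iff_one_le_mul₀ (h3 θ)] at this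

/-- Change of variables on the circle. -/
lemma cov {E : Type*} [NormedAddCommGroup E] [NormedSpace ℝ E] {φ : ℝ → ℝ}
    (h1 : ContDiff ℝ 1 φ) (h2 : ∀ θ, φ (θ + 1) = φ θ + 1)
    (h3 : ∀ θ, 0 < deriv φ θ) (G : ℝ → E) (hG : Function.Periodic G 1) :
    ∫ θ in (0:ℝ)..1, deriv φ θ • G (φ θ) = ∫ θ in (0:ℝ)..1, G θ := by
  have hm := strictMono_of_deriv_pos h3
  have himg : φ '' Set.Ioc 0 1 = Set.Ioc (φ 0) (φ 0 + 1) := by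
    have h01 : φ 1 = φ 0 + 1 := by simpa using h2 0
    ext y
    constructor
    · rintro ⟨x, hx, rfl⟩
      exact ⟨hm hx.1, by rw [← h01]; exact hm.monotone hx.2⟩
    · rintro ⟨hy1, hy2⟩
      refine ⟨Function.invFun φ y, ⟨?_, ?_⟩, phi_inv_right h1 h2 y⟩
      · rw [← hm.lt_iff_lt, phi_inv_right h1 h2]; exact hy1
      · rw [← hm.le_iff_le, phi_inv_right h1 h2, h01]; exact hy2
  have e := integral_image_eq_integral_abs_deriv_smul (s := Set.Ioc (0:ℝ) 1) measurableSet_Ioc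
    (fun x _ => (phi_hasDerivAt h1 x).hasDerivWithinAt) hm.injective.injOn G
  rw [himg] at e
  have e2 := hG.intervalIntegral_add_eq (φ 0) 0
  rw [zero_add, intervalIntegral.integral_of_le (by linarith), e] at e2
  rw [← e2, intervalIntegral.integral_of_le zero_le_one]
  simp only [abs_of_pos (h3 _)]

/-- The matrix of the composition operator. -/
def Amat (φ : ℝ → ℝ) (m n : ℤ) : ℂ := cC (fun θ => ee n (φ θ)) m

lemma Amat_zero (φ : ℝ → ℝ) (m : ℤ) (hm : m ≠ 0) : Amat φ m 0 = 0 := by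
  have : (fun θ => ee 0 (φ θ)) = ee 0 := by ext θ; simp [ee]
  rw [Amat, this, cC_ee, if_neg hm]

lemma H0_est {φ : ℝ → ℝ} (h1 : ContDiff ℝ 1 φ) (h2 : ∀ θ, φ (θ + 1) = φ θ + 1)
    (h3 : ∀ θ, 0 < deriv φ θ) (M0 : ℝ) (hM : ∀ θ, 1 ≤ M0 * deriv φ θ) (R S : Finset ℤ)
    (x : ℤ → ℂ) :
    ∑ m ∈ R, ‖∑ n ∈ S, Amat φ m n * x n‖ ^ 2 ≤ M0 * ∑ n ∈ S, ‖x n‖ ^ 2 := by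
  have hφ := h1.continuous
  have hd := phi_deriv_cont h1
  have hv : ∀ n, Continuous fun θ => ee n (φ θ) := fun n => (ee_cont n).comp hφ
  have hu : Continuous fun θ => ∑ n ∈ S, x n * ee n (φ θ) := by fun_prop
  have B := bessel _ hu R
  simp only [cC_sum S x _ hv] at B
  refine B.trans ?_
  rw [← trig_norm S x, ← cov h1 h2 h3 (fun θ => ‖∑ n ∈ S, x n * ee n θ‖ ^ 2)
    (fun θ => by simp only [ee_periodic]), ← intervalIntegral.integral_const_mul]
  refine intervalIntegral.integral_mono_on zero_le_one
    (Continuous.intervalIntegrable (by fun_prop) _ _)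
    (Continuous.intervalIntegrable (by simp only [smul_eq_mul]; fun_prop) _ _) fun θ _ => ?_
  rw [smul_eq_mul, ← mul_assoc]
  exact le_mul_of_one_le_left (by positivity) (hM θ)

lemma H1_est {φ : ℝ → ℝ} (h1 : ContDiff ℝ 1 φ) (h2 : ∀ θ, φ (θ + 1) = φ θ + 1)
    (h3 : ∀ θ, 0 < deriv φ θ) (M1 : ℝ) (hM : ∀ θ, deriv φ θ ≤ M1) (R S : Finset ℤ)
    (x : ℤ → ℂ) :
    ∑ m ∈ R, (m:ℝ) ^ 2 * ‖∑ n ∈ S, Amat φ m n * x n‖ ^ 2 ≤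
      M1 * ∑ n ∈ S, (n:ℝ) ^ 2 * ‖x n‖ ^ 2 := by
  have hφ := h1.continuous
  have hd := phi_deriv_cont h1
  have hv : ∀ n, Continuous fun θ => ee n (φ θ) := fun n => (ee_cont n).comp hφ
  let k : ℂ := 2 * Real.pi * Complex.I
  have hk : ‖k‖ ≠ 0 := by
    simp [k, Real.pi_ne_zero]
  let u : ℝ → ℂ := fun θ => ∑ n ∈ S, x n * ee n (φ θ)
  let p' : ℝ → ℂ := fun y => ∑ n ∈ S, (k * n * x n) * ee n y
  let u' : ℝ → ℂ := fun θ => deriv φ θ • p' (φ θ)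
  have hp'c : Continuous p' := by
    have := ee_cont
    fun_prop
  have hu'c : Continuous u' := hd.smul (hp'c.comp hφ)
  have hder : ∀ θ, HasDerivAt u (u' θ) θ := by
    intro θ
    have : HasDerivAt (fun y => ∑ n ∈ S, x n * ee n y) (p' (φ θ)) (φ θ) := by
      simp only [p']
      refine HasDerivAt.fun_sum fun n _ => ?_
      have hn := (ee_hasDerivAt n (φ θ)).const_mul (x n)
      have e : x n * (2 * Real.pi * Complex.I * n * ee n (φ θ)) = k * n * x n * ee n (φ θ) := by
        simp only [k]; ring
      rwa [e] at hn
    exact this.scomp θ (phi_hasDerivAt h1 θ)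
  have hper : u 1 = u 0 := by
    have : φ 1 = φ 0 + 1 := by simpa using h2 0
    simp only [u, this, ee_periodic]
  have hco : ∀ m, cC u' m = k * m * ∑ n ∈ S, Amat φ m n * x n := by
    intro m
    rw [cC_deriv u u' hder hu'c hper]
    congr 1
    exact cC_sum S x _ hv m
  have B := bessel _ hu'c R
  have N := trig_norm S (fun n => k * n * x n)
  have C := cov h1 h2 h3 (fun θ => ‖p' θ‖ ^ 2) (fun θ => by simp only [p', ee_periodic])
  have I : ∫ θ in (0:ℝ)..1, ‖u' θ‖ ^ 2 ≤ M1 * ∫ θ in (0:ℝ)..1, deriv φ θ • ‖p' (φ θ)‖ ^ 2 := by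
    rw [← intervalIntegral.integral_const_mul]
    refine intervalIntegral.integral_mono_on zero_le_one
      (Continuous.intervalIntegrable (by fun_prop) _ _)
      (Continuous.intervalIntegrable (by simp only [smul_eq_mul]; fun_prop) _ _) fun θ _ => ?_
    simp only [u', norm_smul, smul_eq_mul, mul_pow, Real.norm_eq_abs, sq_abs]
    have := hM θ
    have := h3 θ
    rw [← mul_assoc]
    refine mul_le_mul_of_nonneg_right ?_ (by positivity)
    nlinarith
  rw [C] at I
  change ∫ θ in (0:ℝ)..1, ‖p' θ‖ ^ 2 = _ at N
  rw [N] at I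
  have T := B.trans I
  simp only [hco, norm_mul, mul_pow, mul_assoc, Complex.norm_intCast, sq_abs] at T
  rw [← Finset.mul_sum, ← Finset.mul_sum, mul_left_comm] at T
  exact le_of_mul_le_mul_left T (by positivity)

lemma coeff_comp {φ : ℝ → ℝ} (h1 : ContDiff ℝ 1 φ) (h2 : ∀ θ, φ (θ + 1) = φ θ + 1)
    (h3 : ∀ θ, 0 < deriv φ θ) (f : ℝ → ℝ) (hp : Function.Periodic f 1)
    (hf : IntegrableOn f (Set.Ioc (0:ℝ) 1))
    (hs : Summable fun n => ‖fCoeff f n‖ ^ 2) (m : ℤ) :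
    HasSum (fun n => Amat φ m n * fCoeff f n) (fCoeff (fun θ => f (φ θ)) m) := by
  let h : ℝ → ℂ := fun y =>
    ee (-m) (Function.invFun φ y) * (((deriv φ (Function.invFun φ y))⁻¹ : ℝ) : ℂ)
  have hψ := psi_cont h1 h2 h3
  have hc : Continuous h := by
    refine ((ee_cont _).comp hψ).mul (Complex.continuous_ofReal.comp ?_)
    exact ((phi_deriv_cont h1).comp hψ).inv₀ fun y => (h3 _).ne'
  have hper : Function.Periodic h 1 := by
    intro y
    simp only [h, psi_add_one h1 h2 h3, ee_periodic, phi_deriv_per h2 _]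
  have hval : ∀ θ, ((deriv φ θ : ℝ) : ℂ) * h (φ θ) = ee (-m) θ := by
    intro θ
    simp only [h, phi_inv_left h3]
    have : ((deriv φ θ : ℝ) : ℂ) ≠ 0 := by exact_mod_cast (h3 θ).ne'
    push_cast
    field_simp
  have K := key_real f hf hs h hc hper
  have e1 : (fun n => Amat φ m n * fCoeff f n) =
      fun n : ℤ => (∫ x in (0:ℝ)..1, ee n x * h x) * fCoeff f n := by
    ext n
    congr 1
    rw [← cov h1 h2 h3 (fun x => ee n x * h x) (fun θ => by simp only [ee_periodic, hper θ])]
    rw [Amat, cC]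
    congr 1; ext θ
    rw [← hval, Complex.real_smul]; ring
  have e2 : fCoeff (fun θ => f (φ θ)) m = ∫ x in (0:ℝ)..1, (f x : ℂ) * h x := by
    rw [← cov h1 h2 h3 (fun x => (f x : ℂ) * h x) (fun θ => by simp only [hp θ, hper θ])]
    rw [fCoeff_eq, cC]
    congr 1; ext θ
    rw [← hval, Complex.real_smul]; ring
  rw [e1, e2]
  exact K

lemma scalar_est {φ : ℝ → ℝ} (h1 : ContDiff ℝ 1 φ) (h2 : ∀ θ, φ (θ + 1) = φ θ + 1)
    (h3 : ∀ θ, 0 < deriv φ θ) (M0 M1 : ℝ) (hM00 : 0 ≤ M0) (hM10 : 0 ≤ M1)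
    (hM0 : ∀ θ, 1 ≤ M0 * deriv φ θ) (hM1 : ∀ θ, deriv φ θ ≤ M1)
    (a : ℝ) (ha0 : 0 ≤ a) (ha1 : a ≤ 1)
    (f : ℝ → ℝ) (hp : Function.Periodic f 1)
    (hf : IntegrableOn f (Set.Ioc (0:ℝ) 1))
    (hs : Summable fun n => ‖fCoeff f n‖ ^ 2)
    (hsa : Summable fun n : ℤ => |(n:ℝ)| ^ (2 * a) * ‖fCoeff f n‖ ^ 2) (R : Finset ℤ) :
    ∑ m ∈ R, |(m:ℝ)| ^ (2 * a) * ‖fCoeff (fun θ => f (φ θ)) m‖ ^ 2 ≤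
      M0 ^ (1 - a) * M1 ^ a * ∑' n : ℤ, |(n:ℝ)| ^ (2 * a) * ‖fCoeff f n‖ ^ 2 := by
  have hlim : Filter.Tendsto (fun S : Finset ℤ => ∑ m ∈ R, |(m:ℝ)| ^ (2 * a) *
      ‖∑ n ∈ S, Amat φ m n * fCoeff f n‖ ^ 2) Filter.atTop
      (nhds (∑ m ∈ R, |(m:ℝ)| ^ (2 * a) * ‖fCoeff (fun θ => f (φ θ)) m‖ ^ 2)) := by
    refine tendsto_finsetSum _ fun m _ => ?_
    have : Filter.Tendsto (fun S : Finset ℤ => ∑ n ∈ S, Amat φ m n * fCoeff f n) Filter.atTop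
      (nhds (fCoeff (fun θ => f (φ θ)) m)) := coeff_comp h1 h2 h3 f hp hf hs m
    exact (this.norm.pow 2).const_mul _
  refine le_of_tendsto' hlim fun S => ?_
  have step : ∑ m ∈ R, |(m:ℝ)| ^ (2 * a) * ‖∑ n ∈ S, Amat φ m n * fCoeff f n‖ ^ 2 ≤
      M0 ^ (1 - a) * M1 ^ a * ∑ n ∈ S, |(n:ℝ)| ^ (2 * a) * ‖fCoeff f n‖ ^ 2 := by
    rcases ha0.eq_or_lt with rfl | hpos
    · simpa using H0_est h1 h2 h3 M0 hM0 R S (fCoeff f)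
    · have z : |((0:ℤ):ℝ)| ^ (2 * a) = 0 := by
        rw [Int.cast_zero, abs_zero, Real.zero_rpow (by positivity)]
      have I := interp (Amat φ) (R.erase 0) (S.erase 0) (fun m hm => Finset.ne_of_mem_erase hm)
        (fun m hm => Finset.ne_of_mem_erase hm) M0 M1 hM00 hM10
        (H0_est h1 h2 h3 M0 hM0 _ _) (H1_est h1 h2 h3 M1 hM1 _ _) a ha0 ha1 (fCoeff f)
      have eR : ∑ m ∈ R, |(m:ℝ)| ^ (2 * a) * ‖∑ n ∈ S, Amat φ m n * fCoeff f n‖ ^ 2 =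
          ∑ m ∈ R.erase 0, |(m:ℝ)| ^ (2 * a) *
            ‖∑ n ∈ S.erase 0, Amat φ m n * fCoeff f n‖ ^ 2 := by
        rw [← Finset.sum_erase R (a := 0) (by rw [z, zero_mul])]
        refine Finset.sum_congr rfl fun m hm => ?_
        rw [Finset.sum_erase S]
        rw [Amat_zero φ m (Finset.ne_of_mem_erase hm), zero_mul]
      rw [eR, ← Finset.sum_erase S (a := 0) (by rw [z, zero_mul])]
      exact I
  refine step.trans (mul_le_mul_of_nonneg_left ?_ (by positivity))
  exact hsa.sum_le_tsum S fun _ _ => by positivity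

/-- composition estimate:
`‖f∘φ‖_{Ḣ^a} ≤ ‖(φ⁻¹)_θ‖_∞^{(1-a)/2} ‖φ_θ‖_∞^{a/2} ‖f‖_{Ḣ^a}` for `b > 3/2`,
`0 ≤ a ≤ 1`, `f ∈ H^a(S¹,ℝ^d)` and `φ ∈ D^b(S¹)`. -/
theorem homogeneous_composition_estimate (d : ℕ) (a b : ℝ) (ha0 : 0 ≤ a)
    (ha1 : a ≤ 1) (hb : 3 / 2 < b) (f : ℝ → Edim d) (hf : InH a f)
    (φ : ℝ → ℝ) (hφ : IsSobDiffeo b φ) :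
    homSobNorm a (f ∘ φ) ≤
      (⨆ θ : ℝ, |deriv (Function.invFun φ) θ|) ^ ((1 - a) / 2) *
        (⨆ θ : ℝ, |deriv φ θ|) ^ (a / 2) * homSobNorm a f := by
  obtain ⟨hper, hint, hsum⟩ := hf
  obtain ⟨h1, h2, h3, -⟩ := hφ
  set M0 : ℝ := ⨆ θ : ℝ, |deriv (Function.invFun φ) θ| with hM0
  set M1 : ℝ := ⨆ θ : ℝ, |deriv φ θ| with hM1
  have hM00 : 0 ≤ M0 := Real.iSup_nonneg fun _ => abs_nonneg _
  have hM10 : 0 ≤ M1 := Real.iSup_nonneg fun _ => abs_nonneg _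
  have cn : ∀ n i, ‖fCoeff (fun θ => f θ i) n‖ ^ 2 ≤ coeffNormSq f n := fun n i =>
    Finset.single_le_sum (f := fun i => ‖fCoeff (fun θ => f θ i) n‖ ^ 2)
      (fun _ _ => by positivity) (Finset.mem_univ i)
  have cn0 : ∀ n, 0 ≤ coeffNormSq f n := fun n => Finset.sum_nonneg fun _ _ => by positivity
  have w1 : ∀ n : ℤ, 1 ≤ (1 + (n:ℝ) ^ 2) ^ a := fun n =>
    Real.one_le_rpow (by nlinarith [sq_nonneg (n:ℝ)]) ha0
  have wa : ∀ n : ℤ, |(n:ℝ)| ^ (2 * a) ≤ (1 + (n:ℝ) ^ 2) ^ a := fun n => by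
    rw [Real.rpow_mul (abs_nonneg _)]
    refine Real.rpow_le_rpow (by positivity) ?_ ha0
    rw [Real.rpow_two, sq_abs]; linarith
  have hs : ∀ i, Summable fun n => ‖fCoeff (fun θ => f θ i) n‖ ^ 2 := fun i =>
    Summable.of_nonneg_of_le (fun _ => by positivity) (fun n =>
      (cn n i).trans (le_mul_of_one_le_left (cn0 n) (w1 n))) hsum
  have hsa : ∀ i, Summable fun n : ℤ => |(n:ℝ)| ^ (2 * a) * ‖fCoeff (fun θ => f θ i) n‖ ^ 2 :=
    fun i => Summable.of_nonneg_of_le (fun _ => by positivity) (fun n =>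
      mul_le_mul (wa n) (cn n i) (by positivity) (by positivity)) hsum
  have hK : 0 ≤ M0 ^ (1 - a) * M1 ^ a := by positivity
  have hT : homSobSq a f =
      ∑ i, ∑' n : ℤ, |(n:ℝ)| ^ (2 * a) * ‖fCoeff (fun θ => f θ i) n‖ ^ 2 := by
    rw [← Summable.tsum_finsetSum fun i _ => hsa i]
    simp only [homSobSq, coeffNormSq, Finset.mul_sum]
  have main : homSobSq a (f ∘ φ) ≤ M0 ^ (1 - a) * M1 ^ a * homSobSq a f := by
    have hT0 : 0 ≤ homSobSq a f :=
      tsum_nonneg fun n => mul_nonneg (by positivity) (cn0 n)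
    refine Real.tsum_le_of_sum_le (fun n => mul_nonneg (by positivity)
      (Finset.sum_nonneg fun _ _ => by positivity)) fun R => ?_
    simp only [coeffNormSq, Finset.mul_sum]
    rw [Finset.sum_comm, hT, Finset.mul_sum]
    refine Finset.sum_le_sum fun i _ => ?_
    have hint_i : IntegrableOn (fun θ => f θ i) (Set.Ioc (0:ℝ) 1) :=
      (EuclideanSpace.proj (𝕜 := ℝ) i : Edim d →L[ℝ] ℝ).integrable_comp hint
    exact scalar_est h1 h2 h3 M0 M1 hM00 hM10 (M0_bound h1 h2 h3) (M1_bound h1 h2) a ha0 ha1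
      (fun θ => f θ i) (fun θ => by simp only [hper θ]) hint_i (hs i) (hsa i) R
  calc homSobNorm a (f ∘ φ) ≤ Real.sqrt (M0 ^ (1 - a) * M1 ^ a * homSobSq a f) :=
        Real.sqrt_le_sqrt main
    _ = _ := by
        rw [Real.sqrt_mul hK, Real.sqrt_mul (by positivity), homSobNorm]
        congr 2
        · rw [Real.sqrt_eq_rpow, ← Real.rpow_mul hM00]; congr 1; ring
        · rw [Real.sqrt_eq_rpow, ← Real.rpow_mul hM10]; congr 1; ring

end
end

section
/- Let r > 3/2 and 1/2 < q ≤ r. Then there exists a constant C = C(q,d) > 0 such that for all c ∈ I^r(S¹,ℝ^d), all tangent vectors h along c of class H^r, and all ℓ ∈ (0, l_c], one has ‖h‖_{L^∞(S¹)} ≤ C ( (1/ℓ)( ‖h‖²_{G^0_c} + ℓ^{2q} ‖h‖²_{Ġ^q_c} ) )^{1/2} ≤ C max{ℓ^{−1/2}, ℓ^{q−1/2}} ‖h‖_{G^q_c}. -/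
open MeasureTheory intervalIntegral
open scoped BigOperators ENNReal RealInnerProductSpace

noncomputable section

def co (f : ℝ → ℂ) (n : ℤ) : ℂ :=
  ∫ θ in (0:ℝ)..1,
    Complex.exp (-2 * (Real.pi : ℂ) * Complex.I * (n : ℂ) * (θ : ℂ)) * f θ

lemma fourier_unit (n : ℤ) (x : ℝ) : fourier n (x : AddCircle (1:ℝ)) =
    Complex.exp (2 * (Real.pi : ℂ) * Complex.I * (n : ℂ) * (x : ℂ)) := by
  rw [fourier_coe_apply]; simp

lemma fourier_unit_neg (n : ℤ) (x : ℝ) : fourier (-n) (x : AddCircle (1:ℝ)) =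
    Complex.exp (-2 * (Real.pi : ℂ) * Complex.I * (n : ℂ) * (x : ℂ)) := by
  rw [fourier_unit]; congr 1; push_cast; ring

lemma norm_ex (n : ℤ) (x : ℝ) :
    ‖Complex.exp (2 * (Real.pi : ℂ) * Complex.I * (n : ℂ) * (x : ℂ))‖ = 1 := by
  rw [Complex.norm_exp]
  simp

lemma norm_ex_neg (n : ℤ) (x : ℝ) :
    ‖Complex.exp (-2 * (Real.pi : ℂ) * Complex.I * (n : ℂ) * (x : ℂ))‖ = 1 := by
  rw [Complex.norm_exp]
  simp

lemma co_eq_on (f : ℝ → ℂ) (n : ℤ) :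
    fourierCoeffOn (zero_lt_one' ℝ) f n = co f n := by
  rw [fourierCoeffOn_eq_integral, co]
  have : ∀ x : ℝ, fourier (-n) (x : AddCircle ((1:ℝ) - 0)) =
      Complex.exp (-2 * (Real.pi : ℂ) * Complex.I * (n : ℂ) * (x : ℂ)) := by
    intro x
    rw [fourier_coe_apply]; congr 1; push_cast; ring
  simp only [this, smul_eq_mul]
  simp

lemma plancherel (f : ℝ → ℂ) (hf : ContinuousOn f (Set.Icc 0 1)) :
    HasSum (fun n => ‖co f n‖ ^ 2) (∫ x in (0:ℝ)..1, ‖f x‖ ^ 2) := by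
  have hL : MemLp f 2 (volume.restrict (Set.Ioc (0:ℝ) 1)) := by
    obtain ⟨B, hB⟩ := isCompact_Icc.exists_bound_of_continuousOn hf
    refine MemLp.of_bound ?_ B ?_
    · exact (hf.mono Set.Ioc_subset_Icc_self).aestronglyMeasurable measurableSet_Ioc
    · filter_upwards [ae_restrict_mem measurableSet_Ioc] with x hx
      exact hB x (Set.Ioc_subset_Icc_self hx)
  have := hasSum_sq_fourierCoeffOn (zero_lt_one' ℝ) hL
  simpa [co_eq_on] using this

lemma plancherelE (f : ℝ → ℂ) (hf : ContinuousOn f (Set.Icc 0 1)) :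
    ∑' n, ‖co f n‖ₑ ^ 2 = ENNReal.ofReal (∫ x in (0:ℝ)..1, ‖f x‖ ^ 2) := by
  have h := plancherel f hf
  rw [← h.tsum_eq, ENNReal.ofReal_tsum_of_nonneg (fun n => by positivity) h.summable]
  congr 1; ext n
  rw [ENNReal.ofReal_pow (norm_nonneg _), ofReal_norm]

lemma co_deriv (f f' : ℝ → ℂ) (hf : ∀ x, HasDerivAt f (f' x) x) (hf' : Continuous f')
    (h01 : f 1 = f 0) (n : ℤ) : co f' n = 2 * Real.pi * Complex.I * n * co f n := by
  have hE : ∀ x : ℝ, HasDerivAt (fun x : ℝ =>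
      Complex.exp (-2 * (Real.pi : ℂ) * Complex.I * (n : ℂ) * (x : ℂ)))
      (-2 * (Real.pi : ℂ) * Complex.I * (n : ℂ) *
        Complex.exp (-2 * (Real.pi : ℂ) * Complex.I * (n : ℂ) * (x : ℂ))) x := by
    intro x
    have h1 : HasDerivAt (fun x : ℝ => (-2 * (Real.pi : ℂ) * Complex.I * (n : ℂ) * (x : ℂ)))
      (-2 * (Real.pi : ℂ) * Complex.I * (n : ℂ) * 1) x :=
      (Complex.ofRealCLM.hasDerivAt (x := x)).const_mul _
    convert! h1.cexp using 1; ring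
  have := integral_mul_deriv_eq_deriv_mul (a := 0) (b := 1) (fun x _ => hE x) (fun x _ => hf x)
    (by apply Continuous.intervalIntegrable; fun_prop) (hf'.intervalIntegrable _ _)
  rw [co, this, co, ← intervalIntegral.integral_const_mul]
  have e1 : Complex.exp (-2 * (Real.pi : ℂ) * Complex.I * (n : ℂ) * ((1:ℝ) : ℂ)) = 1 := by
    rw [Complex.exp_eq_one_iff]; exact ⟨-n, by push_cast; ring⟩
  rw [e1, h01]
  simp only [Complex.ofReal_zero, mul_zero, Complex.exp_zero, one_mul, sub_self, zero_sub]
  rw [← intervalIntegral.integral_neg]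
  congr 1; ext x; ring

lemma co_add (f g : ℝ → ℂ) (hf : ContinuousOn f (Set.Icc 0 1)) (hg : ContinuousOn g (Set.Icc 0 1))
    (n : ℤ) : co (fun x => f x + g x) n = co f n + co g n := by
  unfold co
  rw [← intervalIntegral.integral_add]
  · congr 1; ext x; ring
  · apply ContinuousOn.intervalIntegrable_of_Icc zero_le_one
    exact Continuous.continuousOn (by fun_prop) |>.mul hf
  · apply ContinuousOn.intervalIntegrable_of_Icc zero_le_one
    exact Continuous.continuousOn (by fun_prop) |>.mul hg

lemma co_const_mul (a : ℂ) (f : ℝ → ℂ) (n : ℤ) : co (fun x => a * f x) n = a * co f n := by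
  unfold co
  rw [← intervalIntegral.integral_const_mul]
  congr 1; ext x; ring

lemma co_sum {ι : Type*} (s : Finset ι) (f : ι → ℝ → ℂ) (hf : ∀ i ∈ s, Continuous (f i)) (n : ℤ) :
    co (fun x => ∑ i ∈ s, f i x) n = ∑ i ∈ s, co (f i) n := by
  unfold co
  rw [← intervalIntegral.integral_finsetSum]
  · congr 1; ext x; rw [Finset.mul_sum]
  · intro i hi
    apply Continuous.intervalIntegrable
    exact Continuous.mul (by fun_prop) (hf i hi)

lemma co_ex (m n : ℤ) :
    co (fun x : ℝ => Complex.exp (2 * (Real.pi : ℂ) * Complex.I * (m : ℂ) * (x : ℂ))) n =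
      if n = m then 1 else 0 := by
  have := congrFun (fourierCoeff_fourier (T := (1:ℝ)) m) n
  rw [fourierCoeff_eq_intervalIntegral _ _ 0] at this
  simp only [fourier_unit_neg, fourier_unit, smul_eq_mul] at this
  simp only [zero_add] at this
  rw [Pi.single_apply] at this
  rw [← this, co]; simp

/-- pointwise Fourier expansion -/
lemma expand (f : ℝ → ℂ) (hf : Continuous f) (hp : Function.Periodic f 1)
    (hs : Summable (fun n => ‖co f n‖)) (x : ℝ) :
    HasSum (fun n : ℤ => co f n * Complex.exp (2 * (Real.pi : ℂ) * Complex.I * (n : ℂ) * (x : ℂ)))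
      (f x) := by
  let F : C(AddCircle (1:ℝ), ℂ) := ⟨hp.lift, continuous_coinduced_dom.mpr hf⟩
  have hF : ∀ n, fourierCoeff F n = co f n := by
    intro n
    rw [fourierCoeff_eq_intervalIntegral _ _ 0]
    simp only [fourier_unit_neg, smul_eq_mul, zero_add, co]
    simp [F]
  have h2 : Summable (fourierCoeff F) := by
    apply Summable.of_norm; simpa [hF] using hs
  have := has_pointwise_sum_fourier_series_of_summable h2 (x : AddCircle (1:ℝ))
  simp only [hF, fourier_unit, smul_eq_mul] at this
  exact this

lemma co_conj (f : ℝ → ℝ) (n : ℤ) :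
    (starRingEnd ℂ) (co (fun x => (f x : ℂ)) n) = co (fun x => (f x : ℂ)) (-n) := by
  unfold co
  rw [← intervalIntegral_conj]
  congr 1; ext x
  rw [map_mul, ← Complex.exp_conj]
  have h2 : (starRingEnd ℂ) 2 = 2 := Complex.conj_ofNat 2
  simp [h2]

lemma co_translate (f : ℝ → ℂ) (hp : Function.Periodic f 1) (t : ℝ) (n : ℤ) :
    co (fun x => f (x + t)) n =
      Complex.exp (2 * (Real.pi : ℂ) * Complex.I * (n : ℂ) * (t : ℂ)) * co f n := by
  unfold co
  rw [← intervalIntegral.integral_const_mul]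
  have hper : Function.Periodic (fun x : ℝ =>
    Complex.exp (2 * (Real.pi : ℂ) * Complex.I * (n : ℂ) * (t : ℂ)) *
      (Complex.exp (-2 * (Real.pi : ℂ) * Complex.I * (n : ℂ) * (x : ℂ)) * f x)) 1 := by
    intro x
    simp only [hp x]
    congr 2
    rw [Complex.exp_eq_exp_iff_exists_int]
    exact ⟨-n, by push_cast; ring⟩
  have h1 := hper.intervalIntegral_add_eq t 0
  rw [zero_add] at h1
  rw [← h1]
  have := intervalIntegral.integral_comp_add_right (a := 0) (b := 1) (fun x : ℝ =>
    Complex.exp (2 * (Real.pi : ℂ) * Complex.I * (n : ℂ) * (t : ℂ)) *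
      (Complex.exp (-2 * (Real.pi : ℂ) * Complex.I * (n : ℂ) * (x : ℂ)) * f x)) t
  rw [zero_add, add_comm 1 t] at this
  rw [← this]
  congr 1; ext x
  rw [← mul_assoc, ← Complex.exp_add]
  congr 2
  push_cast; ring

/-- Cauchy-Schwarz for sums in `ℝ≥0∞`, squared form. -/
lemma cs_tsum {ι : Type*} (f g : ι → ℝ≥0∞) :
    (∑' i, f i * g i) ^ 2 ≤ (∑' i, f i ^ 2) * (∑' i, g i ^ 2) := by
  let _ : MeasurableSpace ι := ⊤
  have h := ENNReal.lintegral_mul_le_Lp_mul_Lq (Measure.count : Measure ι)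
    (p := 2) (q := 2) (by constructor <;> norm_num)
    (f := f) (g := g) (measurable_from_top.aemeasurable) (measurable_from_top.aemeasurable)
  simp only [lintegral_count, Pi.mul_apply] at h
  have h2 := pow_le_pow_left' h 2
  rw [mul_pow] at h2
  have e : ∀ x : ℝ≥0∞, (x ^ (1 / (2:ℝ))) ^ 2 = x := by
    intro x
    rw [← ENNReal.rpow_natCast, ← ENNReal.rpow_mul]; norm_num
  rw [e, e] at h2
  simpa using h2

lemma add_sq_le4 (x y : ℝ≥0∞) : (x + y) ^ 2 ≤ 4 * (x ^ 2 + y ^ 2) := by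
  rcases le_total x y with h | h
  · calc (x + y) ^ 2 ≤ (y + y) ^ 2 := by gcongr
      _ = 4 * y ^ 2 := by ring
      _ ≤ _ := by gcongr; exact le_add_self
  · calc (x + y) ^ 2 ≤ (x + x) ^ 2 := by gcongr
      _ = 4 * x ^ 2 := by ring
      _ ≤ _ := by gcongr; exact le_self_add

/-- Young's inequality `ℓ¹ * ℓ² ⊂ ℓ²`. -/
lemma young (X Y : ℤ → ℝ≥0∞) :
    ∑' n, (∑' k, X k * Y (n - k)) ^ 2 ≤ (∑' k, X k) ^ 2 * ∑' n, Y n ^ 2 := by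
  have h1 : ∀ n, (∑' k, X k * Y (n - k)) ^ 2 ≤ (∑' k, X k) * ∑' k, X k * Y (n - k) ^ 2 := by
    intro n
    have := cs_tsum (fun k => X k ^ (1/2:ℝ)) (fun k => X k ^ (1/2:ℝ) * Y (n - k))
    have e : ∀ x : ℝ≥0∞, x ^ (1/2:ℝ) * x ^ (1/2:ℝ) = x := by
      intro x
      rw [← ENNReal.rpow_add_of_nonneg _ _ (by norm_num) (by norm_num)]; norm_num
    simpa only [← mul_assoc, mul_pow, sq (_ ^ (1/2:ℝ)), e] using this
  calc _ ≤ ∑' n, (∑' k, X k) * ∑' k, X k * Y (n - k) ^ 2 := ENNReal.tsum_le_tsum h1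
    _ = (∑' k, X k) * ∑' k, ∑' n, X k * Y (n - k) ^ 2 := by
        rw [ENNReal.tsum_mul_left, ENNReal.tsum_comm]
    _ = (∑' k, X k) * ∑' k, X k * ∑' n, Y n ^ 2 := by
        congr 2; ext k
        rw [ENNReal.tsum_mul_left]
        congr 1
        exact (Equiv.subRight k).tsum_eq (fun n => Y n ^ 2)
    _ = _ := by rw [ENNReal.tsum_mul_right]; ring

/-- Japanese bracket power `⟨n⟩^b` in `ℝ≥0∞`. -/
def jb (b : ℝ) (n : ℤ) : ℝ≥0∞ := ENNReal.ofReal ((1 + (n:ℝ) ^ 2) ^ (b / 2))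

lemma jb_pos (b : ℝ) (n : ℤ) : jb b n ≠ 0 := by
  unfold jb; simp; positivity
lemma jb_top (b : ℝ) (n : ℤ) : jb b n ≠ ⊤ := ENNReal.ofReal_ne_top
lemma jb_add (a b : ℝ) (n : ℤ) : jb (a + b) n = jb a n * jb b n := by
  unfold jb
  rw [← ENNReal.ofReal_mul (by positivity), ← Real.rpow_add (by positivity)]
  congr 2; ring
lemma jb_zero (n : ℤ) : jb 0 n = 1 := by simp [jb]
lemma jb_mono {a b : ℝ} (h : a ≤ b) (n : ℤ) : jb a n ≤ jb b n := by
  unfold jb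
  apply ENNReal.ofReal_le_ofReal
  apply Real.rpow_le_rpow_of_exponent_le _ (by linarith)
  nlinarith [sq_nonneg (n:ℝ)]
lemma jb_sq (b : ℝ) (n : ℤ) : jb b n ^ 2 = ENNReal.ofReal ((1 + (n:ℝ) ^ 2) ^ b) := by
  rw [sq, ← jb_add]; unfold jb; congr 2; ring

lemma jb_sum {a : ℝ} (ha : 1 / 2 < a) : ∑' n, jb (-a) n ^ 2 ≠ ⊤ := by
  simp only [jb_sq]
  have hs : Summable (fun n : ℤ => (1 + (n:ℝ) ^ 2) ^ (-a)) := by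
    have h1 := Real.summable_abs_int_rpow (b := 2 * a) (by linarith)
    refine Summable.of_norm_bounded_eventually h1 ?_
    have : ({0} : Set ℤ)ᶜ ∈ Filter.cofinite := (Set.finite_singleton 0).compl_mem_cofinite
    filter_upwards [this] with n hn
    have hn0 : (0:ℝ) < |(n:ℝ)| := by
      have : n ≠ 0 := hn
      positivity
    rw [Real.norm_of_nonneg (by positivity)]
    have e : |(n:ℝ)| ^ (-(2 * a)) = ((n:ℝ) ^ 2) ^ (-a) := by
      rw [← sq_abs, ← Real.rpow_natCast, ← Real.rpow_mul hn0.le]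
      congr 1; push_cast; ring
    rw [e]
    apply Real.rpow_le_rpow_of_nonpos _ (by linarith) (by linarith)
    rw [← sq_abs]; positivity
  rw [← ENNReal.ofReal_tsum_of_nonneg (fun n => by positivity) hs]
  exact ENNReal.ofReal_ne_top

lemma jb_peetre {a b : ℝ} (hb : 0 ≤ b) (hba : b ≤ a) (k m : ℤ) :
    jb b (k + m) ≤ ENNReal.ofReal (4 ^ (b / 2)) * (jb a k * (jb (-a) m * jb b m) + jb b m) := by
  have key : ∀ j : ℤ, (1 + (k:ℝ) ^ 2) ≤ 1 + (j:ℝ)^2 → (1 + (m:ℝ) ^ 2) ≤ 1 + (j:ℝ)^2 →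
      jb b (k + m) ≤ ENNReal.ofReal (4 ^ (b / 2)) * jb b j := by
    intro j h1 h2
    unfold jb
    rw [← ENNReal.ofReal_mul (by positivity), ← Real.mul_rpow (by norm_num) (by positivity)]
    apply ENNReal.ofReal_le_ofReal
    apply Real.rpow_le_rpow (by positivity) _ (by linarith)
    push_cast
    nlinarith [sq_nonneg ((k:ℝ) - m)]
  rcases le_total (1 + (k:ℝ) ^ 2) (1 + (m:ℝ) ^ 2) with h | h
  · refine (key m h le_rfl).trans ?_
    gcongr
    exact le_add_self
  · refine (key k le_rfl h).trans ?_
    gcongr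
    refine le_trans ?_ le_self_add
    have e1 : jb b k = jb a k * jb (b - a) k := by rw [← jb_add]; congr 1; ring
    rw [e1]
    gcongr
    rw [← jb_add]
    have e2 : -a + b = b - a := by ring
    rw [e2]
    unfold jb
    apply ENNReal.ofReal_le_ofReal
    apply Real.rpow_le_rpow_of_nonpos (by positivity) h (by linarith)

/-- Squared Sobolev norm in `ℝ≥0∞`. -/
def SS (b : ℝ) (f : ℝ → ℂ) : ℝ≥0∞ := ∑' n, (jb b n * ‖co f n‖ₑ) ^ 2

lemma l1_le {a : ℝ} (X : ℤ → ℝ≥0∞) :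
    (∑' n, X n) ^ 2 ≤ (∑' n, jb (-a) n ^ 2) * ∑' n, (jb a n * X n) ^ 2 := by
  refine le_trans (le_of_eq ?_) (cs_tsum _ _)
  congr 2; ext n
  rw [← mul_assoc, ← jb_add]; simp [jb_zero]

lemma SS_mono {a b : ℝ} (h : a ≤ b) (f : ℝ → ℂ) : SS a f ≤ SS b f := by
  unfold SS
  gcongr
  exact jb_mono h _

lemma summable_co {a : ℝ} (ha : 1 / 2 < a) (f : ℝ → ℂ) (hf : SS a f ≠ ⊤) :
    Summable (fun n => ‖co f n‖) := by
  have h := l1_le (a := a) (fun n => ‖co f n‖ₑ)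
  have h2 : (∑' n, ‖co f n‖ₑ) ≠ ⊤ := by
    intro htop
    rw [htop] at h
    have := ENNReal.mul_ne_top (jb_sum ha) hf
    simp only [SS] at this
    apply this
    simpa using h
  have := ENNReal.summable_toReal h2
  simpa using this

lemma co_mul_le {a : ℝ} (ha : 1 / 2 < a) (f g : ℝ → ℂ) (hf : Continuous f)
    (hp : Function.Periodic f 1) (hg : Continuous g) (hS : SS a f ≠ ⊤) (n : ℤ) :
    ‖co (fun x => f x * g x) n‖ₑ ≤ ∑' k, ‖co f k‖ₑ * ‖co g (n - k)‖ₑ := by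
  have hs := summable_co ha f hS
  obtain ⟨B, hB⟩ := isCompact_Icc.exists_bound_of_continuousOn (hg.continuousOn (s := Set.Icc 0 1))
  have key : HasSum (fun k => co f k * co g (n - k)) (co (fun x => f x * g x) n) := by
    have := intervalIntegral.hasSum_integral_of_dominated_convergence (a := 0) (b := 1)
      (μ := volume)
      (F := fun (k : ℤ) (x : ℝ) => co f k *
        (Complex.exp (-2 * (Real.pi : ℂ) * Complex.I * ((n - k : ℤ) : ℂ) * (x : ℂ)) * g x))
      (f := fun x => Complex.exp (-2 * (Real.pi : ℂ) * Complex.I * (n : ℂ) * (x : ℂ)) *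
        (f x * g x))
      (fun k _ => ‖co f k‖ * B) ?_ ?_ ?_ ?_ ?_
    · simp only [intervalIntegral.integral_const_mul] at this
      exact this
    · intro k
      apply Continuous.aestronglyMeasurable; fun_prop
    · intro k
      filter_upwards with x hx
      rw [norm_mul, norm_mul, norm_ex_neg, one_mul]
      gcongr
      apply hB
      rw [Set.uIoc_of_le zero_le_one] at hx
      exact Set.Ioc_subset_Icc_self hx
    · filter_upwards with x hx
      exact hs.mul_right _
    · exact intervalIntegrable_const
    · filter_upwards with x hx
      have h1 := (expand f hf hp hs x).mul_right
        (Complex.exp (-2 * (Real.pi : ℂ) * Complex.I * (n : ℂ) * (x : ℂ)) * g x)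
      convert! h1 using 1
      · ext k
        have e : Complex.exp (-2 * (Real.pi : ℂ) * Complex.I * ((n - k : ℤ) : ℂ) * (x : ℂ)) =
            Complex.exp (2 * (Real.pi : ℂ) * Complex.I * (k : ℂ) * (x : ℂ)) *
            Complex.exp (-2 * (Real.pi : ℂ) * Complex.I * (n : ℂ) * (x : ℂ)) := by
          rw [← Complex.exp_add]; congr 1; push_cast; ring
        rw [e]; ring
      · ring
  rw [← key.tsum_eq]
  refine (enorm_tsum_le_tsum_enorm).trans ?_
  simp [enorm_mul]

lemma SS_mul {a b : ℝ} (ha : 1 / 2 < a) (hb : 0 ≤ b) (hba : b ≤ a) :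
    ∃ C : ℝ≥0∞, C ≠ ⊤ ∧ ∀ f g : ℝ → ℂ, Continuous f → Function.Periodic f 1 → Continuous g →
      SS a f ≠ ⊤ → SS b (fun x => f x * g x) ≤ C * SS a f * SS b g := by
  set J := ∑' n, jb (-a) n ^ 2 with hJ
  set c := ENNReal.ofReal (4 ^ (b / 2)) with hc
  refine ⟨c ^ 2 * (8 * J), by
    have := jb_sum ha
    finiteness, ?_⟩
  intro f g hf hp hg hS
  set X : ℤ → ℝ≥0∞ := fun k => ‖co f k‖ₑ
  set Y : ℤ → ℝ≥0∞ := fun k => ‖co g k‖ₑ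
  set A : ℤ → ℝ≥0∞ := fun k => jb a k * X k
  set B : ℤ → ℝ≥0∞ := fun k => jb b k * Y k
  set B' : ℤ → ℝ≥0∞ := fun k => jb (-a) k * B k
  have h1 : ∀ n, jb b n * ‖co (fun x => f x * g x) n‖ₑ ≤
      c * ((∑' k, B' k * A (n - k)) + ∑' k, X k * B (n - k)) := by
    intro n
    calc _ ≤ jb b n * ∑' k, X k * Y (n - k) := by
          gcongr; exact co_mul_le ha f g hf hp hg hS n
      _ = ∑' k, jb b n * (X k * Y (n - k)) := by rw [ENNReal.tsum_mul_left]
      _ ≤ ∑' k, c * (B' (n - k) * A k + X k * B (n - k)) := by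
          apply ENNReal.tsum_le_tsum
          intro k
          have := jb_peetre hb hba k (n - k)
          rw [add_sub_cancel] at this
          calc _ ≤ (c * (jb a k * (jb (-a) (n-k) * jb b (n-k)) + jb b (n-k))) * (X k * Y (n - k)) := by
                gcongr
            _ = _ := by simp only [A, B, B']; ring
      _ = _ := by
          rw [ENNReal.tsum_mul_left, ENNReal.tsum_add]
          congr 2
          rw [← (Equiv.subLeft n).tsum_eq (fun k => B' k * A (n - k))]
          simp
  have hA : ∑' n, A n ^ 2 = SS a f := rfl
  have hB : ∑' n, B n ^ 2 = SS b g := rfl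
  have hX : (∑' k, X k) ^ 2 ≤ J * SS a f := l1_le X
  have hB' : (∑' k, B' k) ^ 2 ≤ J * SS b g := cs_tsum _ _
  calc SS b (fun x => f x * g x) ≤ ∑' n, (c * ((∑' k, B' k * A (n - k)) + ∑' k, X k * B (n - k))) ^ 2 := by
        unfold SS
        apply ENNReal.tsum_le_tsum
        intro n
        exact pow_le_pow_left' (h1 n) 2
    _ ≤ ∑' n, c ^ 2 * (4 * ((∑' k, B' k * A (n - k)) ^ 2 + (∑' k, X k * B (n - k)) ^ 2)) := by
        apply ENNReal.tsum_le_tsum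
        intro n
        rw [mul_pow]
        gcongr
        exact add_sq_le4 _ _
    _ = c ^ 2 * (4 * ((∑' n, (∑' k, B' k * A (n - k)) ^ 2) + ∑' n, (∑' k, X k * B (n - k)) ^ 2)) := by
        rw [ENNReal.tsum_mul_left, ENNReal.tsum_mul_left, ENNReal.tsum_add]
    _ ≤ c ^ 2 * (4 * ((∑' k, B' k) ^ 2 * SS a f + (∑' k, X k) ^ 2 * SS b g)) := by
        gcongr
        · exact young _ _
        · exact young _ _
    _ ≤ c ^ 2 * (4 * ((J * SS b g) * SS a f + (J * SS a f) * SS b g)) := by gcongr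
    _ = _ := by ring

/-- Mellin-type integral of a kernel. -/
def KI (s : ℝ) (m : ℝ → ℝ≥0∞) : ℝ≥0∞ :=
  ∫⁻ t in Set.Ioi (0:ℝ), ENNReal.ofReal (t ^ (-1 - 2 * s)) * m t

lemma KI_scale (s : ℝ) (m : ℝ → ℝ≥0∞) {a : ℝ} (ha : 0 < a) :
    ∫⁻ t in Set.Ioi (0:ℝ), ENNReal.ofReal (t ^ (-1 - 2 * s)) * m (a * t) =
      ENNReal.ofReal (a ^ (2 * s)) * KI s m := by
  have himg : Set.image (fun t => a * t) (Set.Ioi (0:ℝ)) = Set.Ioi 0 := by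
    ext y; constructor
    · rintro ⟨t, ht, rfl⟩; exact mul_pos ha ht
    · intro hy; exact ⟨y / a, div_pos hy ha, by field_simp⟩
  have h := lintegral_image_eq_lintegral_abs_deriv_mul (s := Set.Ioi (0:ℝ)) (f := fun t => a * t)
    (f' := fun _ => a) measurableSet_Ioi
    (fun x _ => by simpa using ((hasDerivAt_id x).const_mul a).hasDerivWithinAt)
    (fun x _ y _ h => mul_left_cancel₀ ha.ne' h)
    (fun t => ENNReal.ofReal (t ^ (-1 - 2 * s)) * m t)
  rw [himg] at h
  rw [KI, h, ← lintegral_const_mul' _ _ ENNReal.ofReal_ne_top]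
  apply setLIntegral_congr_fun measurableSet_Ioi
  intro t ht
  have ht : 0 < t := ht
  simp only
  rw [← mul_assoc, ← mul_assoc, abs_of_pos ha, ← ENNReal.ofReal_mul (by positivity),
    ← ENNReal.ofReal_mul (by positivity)]
  congr 2
  rw [Real.mul_rpow ha.le ht.le]
  have : a ^ (2 * s) * a * (a ^ (-1 - 2 * s)) = 1 := by
    nth_rewrite 2 [← Real.rpow_one a]
    rw [← Real.rpow_add ha, ← Real.rpow_add ha]
    ring_nf; simp
  linear_combination (- t ^ (-1 - 2 * s)) * this

lemma KI_min_ne_top {s : ℝ} (h0 : 0 < s) (h1 : s < 1) :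
    KI s (fun x => ENNReal.ofReal (min 1 (x ^ 2))) ≠ ⊤ := by
  rw [KI, ← Set.Ioc_union_Ioi_eq_Ioi zero_le_one]
  refine ne_top_of_le_ne_top ?_ (lintegral_union_le _ _ _)
  refine ENNReal.add_ne_top.mpr ⟨?_, ?_⟩
  · have hi : IntegrableOn (fun t : ℝ => t ^ (1 - 2 * s)) (Set.Ioc 0 1) := by
      rw [← intervalIntegrable_iff_integrableOn_Ioc_of_le zero_le_one]
      exact intervalIntegral.intervalIntegrable_rpow' (by linarith)
    refine ne_top_of_le_ne_top hi.lintegral_lt_top.ne ?_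
    apply setLIntegral_mono' measurableSet_Ioc
    intro t ht
    rw [← ENNReal.ofReal_mul (Real.rpow_nonneg ht.1.le _)]
    apply ENNReal.ofReal_le_ofReal
    have : t ^ (1 - 2 * s) = t ^ (-1 - 2 * s) * t ^ 2 := by
      rw [← Real.rpow_natCast, ← Real.rpow_add ht.1]; congr 1; push_cast; ring
    rw [this]
    have := Real.rpow_nonneg ht.1.le (-1 - 2 * s)
    gcongr
    exact min_le_right _ _
  · have hi : IntegrableOn (fun t : ℝ => t ^ (-1 - 2 * s)) (Set.Ioi 1) :=
      integrableOn_Ioi_rpow_of_lt (by linarith) one_pos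
    refine ne_top_of_le_ne_top hi.lintegral_lt_top.ne ?_
    apply setLIntegral_mono' measurableSet_Ioi
    intro t ht
    calc _ ≤ ENNReal.ofReal (t ^ (-1 - 2 * s)) * 1 := by
          gcongr; simp
      _ = _ := mul_one _

lemma KI_ne_top {s : ℝ} (h0 : 0 < s) (h1 : s < 1) (m : ℝ → ℝ≥0∞) (C : ℝ≥0∞) (hC : C ≠ ⊤)
    (hm : ∀ x, m x ≤ C * ENNReal.ofReal (min 1 (x ^ 2))) : KI s m ≠ ⊤ := by
  refine ne_top_of_le_ne_top (ENNReal.mul_ne_top hC (KI_min_ne_top h0 h1)) ?_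
  rw [KI, KI, ← lintegral_const_mul' _ _ hC]
  apply lintegral_mono
  intro t
  calc ENNReal.ofReal (t ^ (-1 - 2 * s)) * m t
      ≤ ENNReal.ofReal (t ^ (-1 - 2 * s)) * (C * ENNReal.ofReal (min 1 (t ^ 2))) := by
        gcongr; exact hm t
    _ = _ := by ring

lemma KI_pos {s : ℝ} (m : ℝ → ℝ≥0∞) (hmm : Measurable m)
    (hm : ∀ x ∈ Set.Ioo (0:ℝ) 1, m x ≠ 0) : KI s m ≠ 0 := by
  rw [KI, ← pos_iff_ne_zero, lintegral_pos_iff_support (by fun_prop)]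
  refine lt_of_lt_of_le ?_ (measure_mono (s := Set.Ioo (0:ℝ) 1) ?_)
  · rw [Measure.restrict_apply measurableSet_Ioo]
    have : Set.Ioo (0:ℝ) 1 ∩ Set.Ioi 0 = Set.Ioo 0 1 :=
      Set.inter_eq_left.mpr (fun x hx => hx.1)
    rw [this]; simp
  · intro x hx
    simp only [Function.mem_support]
    refine mul_ne_zero ?_ (hm x hx)
    simp only [ne_eq, ENNReal.ofReal_eq_zero, not_le]
    exact Real.rpow_pos_of_pos hx.1 _

lemma KI_int {s : ℝ} (h0 : 0 < s) (m : ℝ → ℝ≥0∞) (hm0 : m 0 = 0) (n : ℤ) :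
    ∫⁻ t in Set.Ioi (0:ℝ), ENNReal.ofReal (t ^ (-1 - 2 * s)) * m (|(n:ℝ)| * t) =
      ENNReal.ofReal (|(n:ℝ)| ^ (2 * s)) * KI s m := by
  by_cases hn : n = 0
  · subst hn
    have : (0:ℝ) ^ (2 * s) = 0 := Real.zero_rpow (by linarith)
    simp [hm0, this]
  · exact KI_scale s m (by positivity)

/-- Passing from kernel estimates to homogeneous norms. -/
lemma kernel_compare {s : ℝ} (h0 : 0 < s) (h1 : s < 1) (m : ℝ → ℝ≥0∞) (hmm : Measurable m)
    (hm0 : m 0 = 0) (C : ℝ≥0∞) (hC : C ≠ ⊤)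
    (hmC : ∀ x, m x ≤ C * ENNReal.ofReal (min 1 (x ^ 2)))
    (hmp : ∀ x ∈ Set.Ioo (0:ℝ) 1, m x ≠ 0) (a b : ℤ → ℝ≥0∞) (K : ℝ≥0∞) (hK : K ≠ ⊤)
    (h : ∀ t : ℝ, 0 < t → ∑' n : ℤ, m (|(n:ℝ)| * t) * a n ≤ K * ∑' n : ℤ, m (|(n:ℝ)| * t) * b n) :
    ∑' n : ℤ, ENNReal.ofReal (|(n:ℝ)| ^ (2 * s)) * a n ≤
      K * ∑' n : ℤ, ENNReal.ofReal (|(n:ℝ)| ^ (2 * s)) * b n := by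
  have e : ∀ a : ℤ → ℝ≥0∞, KI s m * ∑' n : ℤ, ENNReal.ofReal (|(n:ℝ)| ^ (2 * s)) * a n =
      ∫⁻ t in Set.Ioi (0:ℝ), ENNReal.ofReal (t ^ (-1 - 2 * s)) * ∑' n : ℤ, m (|(n:ℝ)| * t) * a n := by
    intro a
    simp only [← ENNReal.tsum_mul_left]
    rw [lintegral_tsum (fun n => by fun_prop)]
    congr 1; ext n
    rw [← mul_assoc, mul_comm (KI s m), ← KI_int h0 m hm0 n, ← lintegral_mul_const _ (by fun_prop)]
    simp only [mul_assoc]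
  have hp := KI_pos (s := s) m hmm hmp
  have ht := KI_ne_top h0 h1 m C hC hmC
  have : KI s m * ∑' n : ℤ, ENNReal.ofReal (|(n:ℝ)| ^ (2 * s)) * a n ≤
     KI s m * (K * ∑' n : ℤ, ENNReal.ofReal (|(n:ℝ)| ^ (2 * s)) * b n) := by
    rw [mul_left_comm, e, e, ← lintegral_const_mul' _ _ hK]
    apply setLIntegral_mono' measurableSet_Ioi
    intro t htt
    rw [mul_left_comm]
    gcongr
    exact h t htt
  exact (ENNReal.mul_le_mul_iff_right hp ht).mp this

/-- Homogeneous squared norm. -/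
def HS (s : ℝ) (f : ℝ → ℂ) : ℝ≥0∞ := ∑' n : ℤ, ENNReal.ofReal (|(n:ℝ)| ^ (2 * s)) * ‖co f n‖ₑ ^ 2

lemma HS_le_SS {s : ℝ} (h0 : 0 ≤ s) (f : ℝ → ℂ) : HS s f ≤ SS s f := by
  unfold HS SS
  apply ENNReal.tsum_le_tsum
  intro n
  rw [mul_pow, jb_sq]
  gcongr
  rw [Real.rpow_mul (abs_nonneg _)]
  apply Real.rpow_le_rpow (by positivity) _ h0
  rw [Real.rpow_two, sq_abs]; linarith

lemma SS_le_HS {s : ℝ} (h0 : 0 ≤ s) (f : ℝ → ℂ) :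
    SS s f ≤ ENNReal.ofReal (2 ^ s) * (SS 0 f + HS s f) := by
  unfold HS SS
  rw [← ENNReal.tsum_add, ← ENNReal.tsum_mul_left]
  apply ENNReal.tsum_le_tsum
  intro n
  rw [mul_pow, jb_sq, jb_zero, one_mul]
  have : ENNReal.ofReal ((1 + (n:ℝ) ^ 2) ^ s) ≤
      ENNReal.ofReal (2 ^ s) * (1 + ENNReal.ofReal (|(n:ℝ)| ^ (2 * s))) := by
    rw [← ENNReal.ofReal_one, ← ENNReal.ofReal_add (by norm_num) (by positivity),
      ← ENNReal.ofReal_mul (by positivity)]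
    apply ENNReal.ofReal_le_ofReal
    have e : |(n:ℝ)| ^ (2 * s) = ((n:ℝ) ^ 2) ^ s := by
      rw [Real.rpow_mul (abs_nonneg _), Real.rpow_two, sq_abs]
    rw [e]
    rcases le_total ((n:ℝ) ^ 2) 1 with h | h
    · calc (1 + (n:ℝ) ^ 2) ^ s ≤ 2 ^ s := Real.rpow_le_rpow (by positivity) (by linarith) h0
        _ ≤ _ := by
          have : 0 ≤ ((n:ℝ) ^ 2) ^ s := by positivity
          have : (0:ℝ) < 2 ^ s := by positivity
          nlinarith
    · calc (1 + (n:ℝ) ^ 2) ^ s ≤ (2 * (n:ℝ) ^ 2) ^ s :=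
            Real.rpow_le_rpow (by positivity) (by linarith) h0
        _ = 2 ^ s * ((n:ℝ) ^ 2) ^ s := Real.mul_rpow (by norm_num) (by positivity)
        _ ≤ _ := by
          have : (0:ℝ) < 2 ^ s := by positivity
          nlinarith
  calc _ ≤ (ENNReal.ofReal (2 ^ s) * (1 + ENNReal.ofReal (|(n:ℝ)| ^ (2 * s)))) * ‖co f n‖ₑ ^ 2 := by
        gcongr
    _ = _ := by ring

section CompSection

/-- Uniformly bi-Lipschitz reparametrizations. -/
structure RepD (ψ ψ' φ : ℝ → ℝ) (δ L : ℝ) : Prop where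
  der : ∀ x, HasDerivAt ψ (ψ' x) x
  cont' : Continuous ψ'
  z : ψ 0 = 0
  o : ψ 1 = 1
  cphi : Continuous φ
  left : ∀ x, φ (ψ x) = x
  right : ∀ x, ψ (φ x) = x
  dpos : 0 < δ
  lb : ∀ x, δ ≤ ψ' x
  ub : ∀ x, ψ' x ≤ L

variable {ψ ψ' φ : ℝ → ℝ} {δ L : ℝ}

lemma RepD.cpsi (R : RepD ψ ψ' φ δ L) : Continuous ψ :=
  continuous_iff_continuousAt.mpr fun x => (R.der x).continuousAt

lemma RepD.phi0 (R : RepD ψ ψ' φ δ L) : φ 0 = 0 := by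
  have := R.left 0; rwa [R.z] at this
lemma RepD.phi1 (R : RepD ψ ψ' φ δ L) : φ 1 = 1 := by
  have := R.left 1; rwa [R.o] at this
lemma RepD.pos (R : RepD ψ ψ' φ δ L) (x : ℝ) : 0 < ψ' x := R.dpos.trans_le (R.lb x)

lemma RepD.int_comp {E : Type*} [NormedAddCommGroup E] [NormedSpace ℝ E] (R : RepD ψ ψ' φ δ L)
    (F : ℝ → E) (hF : Continuous F) :
    ∫ x in (0:ℝ)..1, F (φ x) = ∫ x in (0:ℝ)..1, ψ' x • F x := by
  have := intervalIntegral.integral_deriv_smul_comp (a := 0) (b := 1) (f := ψ) (f' := ψ') (g := fun x => F (φ x))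
    (fun x _ => R.der x) R.cont'.continuousOn (hF.comp R.cphi)
  rw [R.z, R.o] at this
  rw [← this]
  simp [R.left]

lemma RepD.co_comp (R : RepD ψ ψ' φ δ L) (g : ℝ → ℂ) (hg : Continuous g) (n : ℤ) :
    co (fun x => g (φ x)) n = ∫ x in (0:ℝ)..1, ψ' x •
      (Complex.exp (-2 * (Real.pi : ℂ) * Complex.I * (n : ℂ) * (ψ x : ℂ)) * g x) := by
  have hc := R.cpsi
  rw [← R.int_comp (F := fun x => Complex.exp (-2 * (Real.pi : ℂ) * Complex.I * (n : ℂ) * (ψ x : ℂ)) * g x)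
    (by fun_prop), co]
  simp [R.right]

lemma SS_zero (f : ℝ → ℂ) : SS 0 f = ∑' n, ‖co f n‖ₑ ^ 2 := by
  simp [SS, jb_zero]

lemma SS_zero_le (f : ℝ → ℂ) (hf : Continuous f) (B : ℝ) (hB : ∀ x, ‖f x‖ ≤ B) :
    SS 0 f ≤ ENNReal.ofReal (B ^ 2) := by
  rw [SS_zero, plancherelE _ hf.continuousOn]
  apply ENNReal.ofReal_le_ofReal
  have : ∫ x in (0:ℝ)..1, ‖f x‖ ^ 2 ≤ ∫ x in (0:ℝ)..1, B ^ 2 := by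
    apply intervalIntegral.integral_mono_on zero_le_one
    · apply Continuous.intervalIntegrable; fun_prop
    · apply Continuous.intervalIntegrable; fun_prop
    · intro x _
      have := hB x
      gcongr
  simpa using this

lemma RepD.SS0_comp (R : RepD ψ ψ' φ δ L) (g : ℝ → ℂ) (hg : Continuous g) :
    SS 0 (fun x => g (φ x)) = ENNReal.ofReal (∫ x in (0:ℝ)..1, ψ' x * ‖g x‖ ^ 2) := by
  have hc := R.cphi
  rw [SS_zero, plancherelE _ (by fun_prop)]
  rw [R.int_comp (F := fun x => ‖g x‖ ^ 2) (by fun_prop)]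
  rfl

lemma RepD.SS0_comp_le (R : RepD ψ ψ' φ δ L) (g : ℝ → ℂ) (hg : Continuous g) :
    SS 0 (fun x => g (φ x)) ≤ ENNReal.ofReal L * SS 0 g := by
  have hc := R.cont'
  have hL : 0 ≤ L := (R.pos 0).le.trans (R.ub 0)
  rw [R.SS0_comp g hg, SS_zero, plancherelE _ hg.continuousOn, ← ENNReal.ofReal_mul hL]
  apply ENNReal.ofReal_le_ofReal
  rw [← intervalIntegral.integral_const_mul]
  apply intervalIntegral.integral_mono_on zero_le_one
  · apply Continuous.intervalIntegrable; fun_prop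
  · apply Continuous.intervalIntegrable; fun_prop
  · intro x _
    have := R.ub x
    gcongr

lemma RepD.der_comp (R : RepD ψ ψ' φ δ L) (g g' : ℝ → ℂ) (hg : ∀ x, HasDerivAt g (g' x) x) (x : ℝ) :
    HasDerivAt (fun x => g (φ x)) (((ψ' (φ x))⁻¹ : ℝ) * g' (φ x)) x := by
  have h1 : HasDerivAt φ (ψ' (φ x))⁻¹ x :=
    HasDerivAt.of_local_left_inverse R.cphi.continuousAt (R.der _) (R.pos _).ne'
      (Filter.Eventually.of_forall R.right)
  have := (hg (φ x)).scomp x h1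
  have e : (((ψ' (φ x))⁻¹ : ℝ) : ℂ) * g' (φ x) = (ψ' (φ x))⁻¹ • g' (φ x) := by
    rw [Complex.real_smul]
  rw [e]
  exact this

lemma RepD.co_der (R : RepD ψ ψ' φ δ L) (g g' : ℝ → ℂ) (hg : ∀ x, HasDerivAt g (g' x) x)
    (hg' : Continuous g') (hp : Function.Periodic g 1) (n : ℤ) :
    co (fun x => (((ψ' (φ x))⁻¹ : ℝ) * g' (φ x))) n =
      2 * Real.pi * Complex.I * n * co (fun x => g (φ x)) n := by
  have hc := R.cont'
  have hc2 := R.cphi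
  apply co_deriv _ _ (R.der_comp g g' hg)
  · have : Continuous (fun x => (ψ' (φ x))⁻¹) :=
      Continuous.inv₀ (by fun_prop) (fun x => (R.pos _).ne')
    fun_prop
  · rw [R.phi0, R.phi1]
    simpa using hp 0

/-- `Σ n² |f̂(n)|²`. -/
def N1 (f : ℝ → ℂ) : ℝ≥0∞ := ∑' n : ℤ, ENNReal.ofReal ((n:ℝ) ^ 2) * ‖co f n‖ₑ ^ 2

lemma SS0_of_co_der (f f' : ℝ → ℂ) (h : ∀ n, co f' n = 2 * Real.pi * Complex.I * n * co f n) :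
    SS 0 f' = ENNReal.ofReal ((2 * Real.pi) ^ 2) * N1 f := by
  rw [SS_zero, N1, ← ENNReal.tsum_mul_left]
  congr 1; ext n
  rw [h, enorm_mul, mul_pow, ← mul_assoc, ← ENNReal.ofReal_mul (by positivity)]
  congr 1
  rw [← ofReal_norm, ← ENNReal.ofReal_pow (norm_nonneg _)]
  congr 1
  simp [mul_pow]

lemma RepD.N1_comp_le (R : RepD ψ ψ' φ δ L) (g g' : ℝ → ℂ) (hg : ∀ x, HasDerivAt g (g' x) x)
    (hg' : Continuous g') (hp : Function.Periodic g 1) :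
    N1 (fun x => g (φ x)) ≤ ENNReal.ofReal δ⁻¹ * N1 g := by
  have hc := R.cont'
  have hci : Continuous (fun x => (ψ' x)⁻¹) := Continuous.inv₀ hc (fun x => (R.pos _).ne')
  have h1 := SS0_of_co_der _ _ (R.co_der g g' hg hg' hp)
  have h2 := SS0_of_co_der _ _ (co_deriv g g' hg hg' (by simpa using hp 0))
  have h3 : SS 0 (fun x => (((ψ' (φ x))⁻¹ : ℝ) * g' (φ x))) ≤ ENNReal.ofReal δ⁻¹ * SS 0 g' := by
    rw [R.SS0_comp (fun x => (((ψ' x)⁻¹ : ℝ) * g' x)) (by fun_prop), SS_zero,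
      plancherelE _ hg'.continuousOn, ← ENNReal.ofReal_mul (by have := R.dpos; positivity)]
    apply ENNReal.ofReal_le_ofReal
    rw [← intervalIntegral.integral_const_mul]
    apply intervalIntegral.integral_mono_on zero_le_one
    · apply Continuous.intervalIntegrable; fun_prop
    · apply Continuous.intervalIntegrable; fun_prop
    · intro x _
      have hp := R.pos x
      have h1 : (ψ' x)⁻¹ ≤ δ⁻¹ := inv_anti₀ R.dpos (R.lb x)
      rw [norm_mul, mul_pow]
      have : ‖(((ψ' x)⁻¹ : ℝ) : ℂ)‖ = (ψ' x)⁻¹ := by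
        rw [Complex.norm_real, Real.norm_of_nonneg (by positivity)]
      rw [this]
      calc _ = (ψ' x)⁻¹ * ‖g' x‖ ^ 2 := by field_simp
        _ ≤ _ := by gcongr
  rw [h1, h2, mul_left_comm] at h3
  exact (ENNReal.mul_le_mul_iff_right (by simp) ENNReal.ofReal_ne_top).mp h3

/-- truncated Fourier series -/
def trunc (M : ℕ) (g : ℝ → ℂ) (x : ℝ) : ℂ := ∑ m ∈ Finset.Icc (-(M:ℤ)) M, co g m *
  Complex.exp (2 * (Real.pi : ℂ) * Complex.I * (m : ℂ) * (x : ℂ))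

lemma trunc_contDiff (M : ℕ) (g : ℝ → ℂ) (k : ℕ∞) : ContDiff ℝ k (trunc M g) := by
  unfold trunc
  apply ContDiff.sum
  intro m _
  apply contDiff_const.mul
  apply ContDiff.cexp
  apply contDiff_const.mul
  exact Complex.ofRealCLM.contDiff

lemma trunc_periodic (M : ℕ) (g : ℝ → ℂ) : Function.Periodic (trunc M g) 1 := by
  intro x
  unfold trunc
  congr 1; ext m
  congr 1
  rw [Complex.exp_eq_exp_iff_exists_int]
  exact ⟨m, by push_cast; ring⟩

lemma co_trunc (M : ℕ) (g : ℝ → ℂ) (n : ℤ) :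
    co (trunc M g) n = if n ∈ Finset.Icc (-(M:ℤ)) M then co g n else 0 := by
  have : trunc M g = fun x : ℝ => ∑ m ∈ Finset.Icc (-(M:ℤ)) M, co g m *
    Complex.exp (2 * (Real.pi : ℂ) * Complex.I * (m : ℂ) * (x : ℂ)) := rfl
  rw [this, co_sum _ _ (by intro i _; fun_prop)]
  simp only [co_const_mul, co_ex, mul_ite, mul_one, mul_zero]
  rw [Finset.sum_ite_eq]

lemma RepD.kernel_comp (R : RepD ψ ψ' φ δ L) (g : ℝ → ℂ) (hg : Continuous g) (t : ℝ) (ht : 0 < t) :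
    ∑' n : ℤ, ENNReal.ofReal (min 1 ((|(n:ℝ)| * t) ^ 2)) * ‖co (fun x => g (φ x)) n‖ₑ ^ 2 ≤
      4 * (ENNReal.ofReal δ⁻¹ + ENNReal.ofReal L) *
        ∑' n : ℤ, ENNReal.ofReal (min 1 ((|(n:ℝ)| * t) ^ 2)) * ‖co g n‖ₑ ^ 2 := by
  set M : ℕ := ⌊1 / t⌋₊ with hM
  set p := trunc M g with hp
  have hpc : Continuous p := (trunc_contDiff M g 1).continuous
  have hφ := R.cphi
  set k : ℝ → ℂ := fun x => g x + (-1) * p x with hk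
  have hkc : Continuous k := by fun_prop
  have hco : ∀ n, co (fun x => g (φ x)) n = co (fun x => p (φ x)) n + co (fun x => k (φ x)) n := by
    intro n
    rw [← co_add _ _ (by fun_prop) (by fun_prop)]
    congr 1; ext x; simp [hk]
  have hcok : ∀ n, co k n = if n ∈ Finset.Icc (-(M:ℤ)) M then 0 else co g n := by
    intro n
    rw [hk, co_add _ _ (by fun_prop) (by fun_prop), co_const_mul, hp, co_trunc]
    split_ifs <;> simp
  have hN := R.N1_comp_le p (deriv p)
    (fun x => ((trunc_contDiff M g 1).differentiable (by norm_num) x).hasDerivAt)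
    ((trunc_contDiff M g 1).continuous_deriv le_rfl) (trunc_periodic M g)
  have hS := R.SS0_comp_le k hkc
  have mem : ∀ n : ℤ, n ∈ Finset.Icc (-(M:ℤ)) M ↔ |(n:ℝ)| * t ≤ 1 := by
    intro n
    rw [Finset.mem_Icc, ← abs_le, ← le_div_iff₀ ht, ← Int.cast_abs]
    have h0 : (0:ℤ) ≤ |n| := abs_nonneg n
    lift |n| to ℕ using h0 with j
    rw [hM, Nat.cast_le, Nat.le_floor_iff (by positivity)]
    simp
  calc _ ≤ ∑' n : ℤ, 4 * (ENNReal.ofReal (t ^ 2) * (ENNReal.ofReal ((n:ℝ) ^ 2) *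
          ‖co (fun x => p (φ x)) n‖ₑ ^ 2) + ‖co (fun x => k (φ x)) n‖ₑ ^ 2) := by
        apply ENNReal.tsum_le_tsum
        intro n
        rw [hco]
        calc _ ≤ ENNReal.ofReal (min 1 ((|(n:ℝ)| * t) ^ 2)) *
              (4 * (‖co (fun x => p (φ x)) n‖ₑ ^ 2 + ‖co (fun x => k (φ x)) n‖ₑ ^ 2)) := by
              gcongr
              refine le_trans ?_ (add_sq_le4 _ _)
              gcongr
              exact enorm_add_le _ _
          _ = 4 * (ENNReal.ofReal (min 1 ((|(n:ℝ)| * t) ^ 2)) * ‖co (fun x => p (φ x)) n‖ₑ ^ 2 +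
              ENNReal.ofReal (min 1 ((|(n:ℝ)| * t) ^ 2)) * ‖co (fun x => k (φ x)) n‖ₑ ^ 2) := by ring
          _ ≤ _ := by
              refine mul_le_mul_right (add_le_add ?_ ?_) _
              · rw [← mul_assoc, ← ENNReal.ofReal_mul (by positivity)]
                gcongr
                refine (min_le_right _ _).trans (le_of_eq ?_)
                rw [mul_pow, sq_abs]; ring
              · refine mul_le_of_le_one_left' ?_
                simp
    _ = 4 * (ENNReal.ofReal (t ^ 2) * N1 (fun x => p (φ x)) + SS 0 (fun x => k (φ x))) := by
        rw [ENNReal.tsum_mul_left, ENNReal.tsum_add, ENNReal.tsum_mul_left, N1, SS_zero]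
    _ ≤ 4 * (ENNReal.ofReal (t ^ 2) * (ENNReal.ofReal δ⁻¹ * N1 p) + ENNReal.ofReal L * SS 0 k) := by
        gcongr
    _ ≤ 4 * ((ENNReal.ofReal δ⁻¹ + ENNReal.ofReal L) * (ENNReal.ofReal (t ^ 2) * N1 p) +
          (ENNReal.ofReal δ⁻¹ + ENNReal.ofReal L) * SS 0 k) := by
        rw [mul_left_comm (ENNReal.ofReal (t ^ 2))]
        gcongr
        · exact le_self_add
        · exact le_add_self
    _ = 4 * (ENNReal.ofReal δ⁻¹ + ENNReal.ofReal L) * (ENNReal.ofReal (t ^ 2) * N1 p + SS 0 k) := by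
        ring
    _ ≤ _ := by
        gcongr
        rw [N1, SS_zero, ← ENNReal.tsum_mul_left, ← ENNReal.tsum_add]
        apply ENNReal.tsum_le_tsum
        intro n
        rw [hcok, hp, co_trunc]
        by_cases hn : n ∈ Finset.Icc (-(M:ℤ)) M
        · simp only [hn, if_true]
          have h1 := (mem n).mp hn
          have h2 : 0 ≤ |(n:ℝ)| * t := by positivity
          rw [min_eq_right (by nlinarith), ← mul_assoc, ← ENNReal.ofReal_mul (by positivity),
            mul_pow, sq_abs, mul_comm ((n:ℝ)^2)]
          simp
        · simp only [hn, if_false]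
          have h1 := mt (mem n).mpr hn
          push Not at h1
          rw [min_eq_left (by nlinarith)]
          simp

lemma SS_comp_low {s : ℝ} (h0 : 0 ≤ s) (h1 : s < 1) (δ L : ℝ) : ∃ C : ℝ≥0∞, C ≠ ⊤ ∧
    ∀ ψ ψ' φ : ℝ → ℝ, RepD ψ ψ' φ δ L → ∀ g : ℝ → ℂ, Continuous g →
      SS s (fun x => g (φ x)) ≤ C * SS s g := by
  rcases h0.eq_or_lt with rfl | h0
  · exact ⟨ENNReal.ofReal L, ENNReal.ofReal_ne_top, fun ψ ψ' φ R g hg => R.SS0_comp_le g hg⟩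
  set K := 4 * (ENNReal.ofReal δ⁻¹ + ENNReal.ofReal L) with hK
  have hKt : K ≠ ⊤ := by finiteness
  refine ⟨ENNReal.ofReal (2 ^ s) * (ENNReal.ofReal L + K), by finiteness, ?_⟩
  intro ψ ψ' φ R g hg
  have hH : HS s (fun x => g (φ x)) ≤ K * HS s g := by
    apply kernel_compare h0 h1 (fun x => ENNReal.ofReal (min 1 (x ^ 2))) (by fun_prop) (by simp) 1
      (by simp) (by simp) _ _ _ K hKt
    · intro t ht
      exact R.kernel_comp g hg t ht
    · intro x hx
      have := hx.1
      simp
      positivity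
  calc _ ≤ _ := SS_le_HS h0.le _
    _ ≤ ENNReal.ofReal (2 ^ s) * (ENNReal.ofReal L * SS s g + K * SS s g) := by
      gcongr
      · exact (R.SS0_comp_le g hg).trans (by gcongr; exact SS_mono h0.le _)
      · exact hH.trans (by gcongr; exact HS_le_SS h0.le _)
    _ = _ := by ring

/-- Lipschitz images. -/
lemma HS_lip {s : ℝ} (h0 : 0 < s) (h1 : s < 1) (u w : ℝ → ℂ) (hu : Continuous u) (hw : Continuous w)
    (pu : Function.Periodic u 1) (pw : Function.Periodic w 1) (L : ℝ)
    (h : ∀ x y, ‖u x - u y‖ ≤ L * ‖w x - w y‖) :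
    HS s u ≤ ENNReal.ofReal (L ^ 2) * HS s w := by
  have key : ∀ f : ℝ → ℂ, Continuous f → Function.Periodic f 1 → ∀ t : ℝ,
      ∑' n : ℤ, ENNReal.ofReal ((2 * Real.sin (Real.pi * (|(n:ℝ)| * t))) ^ 2) * ‖co f n‖ₑ ^ 2 =
      ENNReal.ofReal (∫ x in (0:ℝ)..1, ‖f (x + t) - f x‖ ^ 2) := by
    intro f hf pf t
    rw [← plancherelE _ (by fun_prop)]
    congr 1; ext n
    have e : co (fun x => f (x + t) - f x) n =
      (Complex.exp (2 * (Real.pi : ℂ) * Complex.I * (n : ℂ) * (t : ℂ)) - 1) * co f n := by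
      have : (fun x => f (x + t) - f x) = fun x => f (x + t) + (-1) * f x := by ext x; ring
      rw [this, co_add _ _ (by fun_prop) (by fun_prop), co_translate f pf, co_const_mul]
      ring
    rw [e, enorm_mul, mul_pow (‖Complex.exp _ - 1‖ₑ)]
    congr 1
    have e2 : (2 * (Real.pi : ℂ) * Complex.I * (n : ℂ) * (t : ℂ)) =
      Complex.I * ((2 * Real.pi * n * t : ℝ) : ℂ) := by push_cast; ring
    rw [← ofReal_norm (Complex.exp _ - 1), ← ENNReal.ofReal_pow (norm_nonneg _), e2,
      Complex.norm_exp_I_mul_ofReal_sub_one, Real.norm_eq_abs, sq_abs]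
    congr 1
    rcases abs_choice (n:ℝ) with hn | hn
    · rw [hn]; congr 3; ring
    · rw [hn, show Real.pi * (-(n:ℝ) * t) = -(2 * Real.pi * n * t / 2) by ring, Real.sin_neg]
      ring
  apply kernel_compare h0 h1 (fun x => ENNReal.ofReal ((2 * Real.sin (Real.pi * x)) ^ 2))
    (by fun_prop) (by simp) (ENNReal.ofReal (4 * Real.pi ^ 2)) ENNReal.ofReal_ne_top _ _ _ _ _
    ENNReal.ofReal_ne_top
  · intro t ht
    rw [key u hu pu, key w hw pw, ← ENNReal.ofReal_mul (by positivity)]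
    apply ENNReal.ofReal_le_ofReal
    rw [← intervalIntegral.integral_const_mul]
    apply intervalIntegral.integral_mono_on zero_le_one
    · apply Continuous.intervalIntegrable; fun_prop
    · apply Continuous.intervalIntegrable; fun_prop
    · intro x _
      rw [← mul_pow]
      have := h (x + t) x
      gcongr
  · intro x
    rw [← ENNReal.ofReal_mul (by positivity)]
    apply ENNReal.ofReal_le_ofReal
    rw [mul_min_of_nonneg _ _ (by positivity)]
    apply le_min
    · have := Real.sin_sq_le_one (Real.pi * x)
      have := Real.pi_gt_three
      nlinarith
    · have h1 : |Real.sin (Real.pi * x)| ≤ |Real.pi * x| := Real.abs_sin_le_abs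
      have := sq_le_sq.mpr h1
      nlinarith
  · intro x hx
    have : 0 < Real.sin (Real.pi * x) :=
      Real.sin_pos_of_pos_of_lt_pi (by have := hx.1; positivity) (by have := hx.2; nlinarith [Real.pi_pos])
    simp
    positivity
end CompSection

lemma SS_up {b : ℝ} (f f' : ℝ → ℂ) (h : ∀ n, co f' n = 2 * Real.pi * Complex.I * n * co f n) :
    SS (b + 1) f ≤ SS 0 f + SS b f' := by
  rw [SS_zero, SS, SS, ← ENNReal.tsum_add]
  apply ENNReal.tsum_le_tsum
  intro n
  by_cases hn : n = 0
  · subst hn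
    simp [jb]
  · refine le_trans ?_ le_add_self
    rw [jb_add, mul_assoc]
    gcongr
    rw [h, enorm_mul]
    gcongr
    rw [← ofReal_norm, jb]
    apply ENNReal.ofReal_le_ofReal
    have h1 : (1:ℝ) ≤ (n:ℝ) ^ 2 := by
      have : 1 ≤ n ^ 2 := by
        have := Int.one_le_abs hn
        rw [← sq_abs]; nlinarith
      exact_mod_cast this
    have h2 := Real.pi_gt_three
    rw [← Real.sqrt_eq_rpow]
    simp only [norm_mul, Complex.norm_real, Complex.norm_I, Complex.norm_intCast]
    apply Real.sqrt_le_iff.mpr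
    constructor
    · positivity
    · simp [mul_pow]
      have : 9 * (n:ℝ)^2 ≤ Real.pi ^ 2 * (n:ℝ)^2 := by
        apply mul_le_mul_of_nonneg_right _ (sq_nonneg _)
        nlinarith
      nlinarith

lemma SS_down {b : ℝ} (f f' : ℝ → ℂ) (h : ∀ n, co f' n = 2 * Real.pi * Complex.I * n * co f n) :
    SS b f' ≤ ENNReal.ofReal ((2 * Real.pi) ^ 2) * SS (b + 1) f := by
  rw [SS, SS, ← ENNReal.tsum_mul_left]
  apply ENNReal.tsum_le_tsum
  intro n
  have : ‖co f' n‖ₑ ≤ ENNReal.ofReal (2 * Real.pi) * (jb 1 n * ‖co f n‖ₑ) := by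
    rw [h, enorm_mul, ← mul_assoc]
    gcongr
    rw [← ofReal_norm, jb, ← ENNReal.ofReal_mul (by positivity)]
    apply ENNReal.ofReal_le_ofReal
    rw [← Real.sqrt_eq_rpow]
    simp only [norm_mul, Complex.norm_real, Complex.norm_I, Complex.norm_intCast]
    simp [abs_of_pos Real.pi_pos]
    gcongr
    apply Real.le_sqrt_of_sq_le
    simp
  calc _ ≤ (jb b n * (ENNReal.ofReal (2 * Real.pi) * (jb 1 n * ‖co f n‖ₑ))) ^ 2 := by gcongr
    _ = _ := by
      rw [jb_add, ENNReal.ofReal_pow (by positivity)]; ring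

/-- uniformly bounded families -/
def BF (b : ℝ) (F : ℕ → ℝ → ℂ) : Prop := ∃ K : ℝ≥0∞, K ≠ ⊤ ∧ ∀ i, SS b (F i) ≤ K
/-- smooth periodic families -/
def SP (F : ℕ → ℝ → ℂ) : Prop := ∀ i, ContDiff ℝ (⊤ : ℕ∞) (F i) ∧ Function.Periodic (F i) 1

lemma SP.cont {F : ℕ → ℝ → ℂ} (h : SP F) (i : ℕ) : Continuous (F i) := (h i).1.continuous
lemma SP.hasDeriv {F : ℕ → ℝ → ℂ} (h : SP F) (i : ℕ) (x : ℝ) :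
    HasDerivAt (F i) (deriv (F i) x) x :=
  (((h i).1.differentiable (by simp)) x).hasDerivAt
lemma SP.deriv {F : ℕ → ℝ → ℂ} (h : SP F) : SP (fun i => deriv (F i)) := by
  intro i
  refine ⟨?_, ?_⟩
  · exact ((contDiff_infty_iff_deriv (𝕜 := ℝ)).mp (h i).1).2
  · intro x
    have : (fun y => F i (y + 1)) = F i := funext (h i).2
    show _root_.deriv (F i) (x + 1) = _root_.deriv (F i) x
    rw [← deriv_comp_add_const, this]
lemma SP.co_der {F : ℕ → ℝ → ℂ} (h : SP F) (i : ℕ) (n : ℤ) :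
    co (_root_.deriv (F i)) n = 2 * Real.pi * Complex.I * n * co (F i) n :=
  co_deriv _ _ (h.hasDeriv i) (h.deriv.cont i) (by simpa using (h i).2 0) n
lemma SP.mul {F G : ℕ → ℝ → ℂ} (h : SP F) (h' : SP G) : SP (fun i x => F i x * G i x) :=
  fun i => ⟨(h i).1.mul (h' i).1, fun x => by simp only [(h i).2 x, (h' i).2 x]⟩

lemma BF.mono {F : ℕ → ℝ → ℂ} {a b : ℝ} (hab : a ≤ b) (h : BF b F) : BF a F := by
  obtain ⟨K, hK, h⟩ := h
  exact ⟨K, hK, fun i => (SS_mono hab _).trans (h i)⟩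
lemma BF.deriv {F : ℕ → ℝ → ℂ} {b : ℝ} (hF : SP F) (h : BF (b + 1) F) : BF b (fun i => deriv (F i)) := by
  obtain ⟨K, hK, h⟩ := h
  refine ⟨ENNReal.ofReal ((2 * Real.pi) ^ 2) * K, by finiteness, fun i => ?_⟩
  exact (SS_down _ _ (hF.co_der i)).trans (by gcongr; exact h i)
lemma BF.up {F F' : ℕ → ℝ → ℂ} {b : ℝ}
    (hF : ∀ i n, co (F' i) n = 2 * Real.pi * Complex.I * n * co (F i) n)
    (h0 : BF 0 F) (h : BF b F') : BF (b + 1) F := by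
  obtain ⟨K, hK, h⟩ := h
  obtain ⟨K', hK', h'⟩ := h0
  refine ⟨K' + K, by finiteness, fun i => ?_⟩
  exact (SS_up _ _ (hF i)).trans (add_le_add (h' i) (h i))
lemma BF.mul {F G : ℕ → ℝ → ℂ} {a b : ℝ} (ha : 1/2 < a) (hb : 0 ≤ b) (hba : b ≤ a)
    (hF : SP F) (hG : SP G) (h : BF a F) (h' : BF b G) : BF b (fun i x => F i x * G i x) := by
  obtain ⟨K, hK, h⟩ := h
  obtain ⟨K', hK', h'⟩ := h'
  obtain ⟨C, hC, H⟩ := SS_mul ha hb hba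
  refine ⟨C * K * K', by finiteness, fun i => ?_⟩
  have hi : SS a (F i) ≠ ⊤ := ((h i).trans_lt hK.lt_top).ne
  refine (H (F i) (G i) (hF.cont i) (hF i).2 (hG.cont i) hi).trans ?_
  gcongr
  · exact h i
  · exact h' i

/-- inverse square roots -/
lemma BF_invsqrt {a δ : ℝ} (ha : 1/2 < a) (hδ : 0 < δ) (w : ℕ → ℝ → ℝ)
    (hs : ∀ i, ContDiff ℝ (⊤ : ℕ∞) (w i)) (hp : ∀ i, Function.Periodic (w i) 1)
    (lb : ∀ i x, δ ≤ w i x) (hb : BF a (fun i x => (w i x : ℂ))) :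
    SP (fun i x => (((Real.sqrt (w i x))⁻¹ : ℝ) : ℂ)) ∧
    BF a (fun i x => (((Real.sqrt (w i x))⁻¹ : ℝ) : ℂ)) := by
  have hpos : ∀ i x, 0 < w i x := fun i x => hδ.trans_le (lb i x)
  have hsp : SP (fun i x => (((Real.sqrt (w i x))⁻¹ : ℝ) : ℂ)) := by
    intro i
    refine ⟨?_, fun x => by simp only [hp i x]⟩
    apply Complex.ofRealCLM.contDiff.comp
    exact ((hs i).sqrt (fun x => (hpos i x).ne')).inv (fun x => (Real.sqrt_pos.mpr (hpos i x)).ne')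
  have hwsp : SP (fun i x => (w i x : ℂ)) := fun i =>
    ⟨Complex.ofRealCLM.contDiff.comp (hs i), fun x => by simp only [hp i x]⟩
  refine ⟨hsp, ?_⟩
  set u : ℕ → ℝ → ℂ := fun i x => (((Real.sqrt (w i x))⁻¹ : ℝ) : ℂ) with hu
  have hbd : ∀ i x, ‖u i x‖ ≤ (Real.sqrt δ)⁻¹ := by
    intro i x
    have := Real.sqrt_pos.mpr (hpos i x)
    rw [hu, Complex.norm_real, Real.norm_of_nonneg (by positivity)]
    exact inv_anti₀ (Real.sqrt_pos.mpr hδ) (Real.sqrt_le_sqrt (lb i x))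
  have h0 : BF 0 u := ⟨_, ENNReal.ofReal_ne_top, fun i => SS_zero_le _ (hsp.cont i) _ (hbd i)⟩
  set L : ℝ := (Real.sqrt δ)⁻¹ * (Real.sqrt δ)⁻¹ * (Real.sqrt δ)⁻¹ with hL
  have hlip : ∀ i x y, ‖u i x - u i y‖ ≤ L * ‖((w i x : ℂ)) - (w i y : ℂ)‖ := by
    intro i x y
    rw [hu, ← Complex.ofReal_sub, ← Complex.ofReal_sub, Complex.norm_real, Complex.norm_real,
      Real.norm_eq_abs, Real.norm_eq_abs]
    have e1 := Real.sq_sqrt (hpos i x).le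
    have e2 := Real.sq_sqrt (hpos i y).le
    have l1 := Real.sqrt_le_sqrt (lb i x)
    have l2 := Real.sqrt_le_sqrt (lb i y)
    have l0 := Real.sqrt_pos.mpr hδ
    set s := Real.sqrt (w i x)
    set t := Real.sqrt (w i y)
    set e := Real.sqrt δ
    have hs : 0 < s := l0.trans_le l1
    have ht : 0 < t := l0.trans_le l2
    have : s⁻¹ - t⁻¹ = (s⁻¹ * t⁻¹ * (s + t)⁻¹) * (w i y - w i x) := by
      rw [← e1, ← e2]; field_simp; ring
    rw [this, abs_mul, abs_sub_comm, abs_of_pos (by positivity), hL]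
    have i1 : s⁻¹ ≤ e⁻¹ := inv_anti₀ l0 l1
    have i2 : t⁻¹ ≤ e⁻¹ := inv_anti₀ l0 l2
    have i3 : (s+t)⁻¹ ≤ e⁻¹ := inv_anti₀ l0 (by linarith)
    gcongr
  -- base case
  have base : ∀ s, 0 < s → s < 1 → s ≤ a → BF s u := by
    intro s hs0 hs1 hsa
    obtain ⟨K, hK, h⟩ := hb.mono hsa
    obtain ⟨K', hK', h'⟩ := h0
    refine ⟨ENNReal.ofReal (2 ^ s) * (K' + ENNReal.ofReal (L ^ 2) * K), by finiteness, fun i => ?_⟩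
    refine (SS_le_HS hs0.le _).trans ?_
    gcongr
    · exact h' i
    · refine (HS_lip hs0 hs1 (u i) _ (hsp.cont i) (hwsp.cont i) (hsp i).2 (hwsp i).2 L (hlip i)).trans ?_
      gcongr
      exact (HS_le_SS hs0.le _).trans (h i)
  rcases lt_or_ge a 1 with ha1 | ha1
  · exact base a (by linarith) ha1 le_rfl
  have step : ∀ b, 1/2 < b → b ≤ a → BF b u → BF (min b (a - 1) + 1) u := by
    intro b hb1 hba hbu
    have hm0 : 0 ≤ min b (a-1) := le_min (by linarith) (by linarith)
    have hw' : BF (a - 1) (fun i => deriv (fun x => (w i x : ℂ))) :=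
      BF.deriv hwsp (by simpa using hb)
    have h2 := BF.mul hb1 (by linarith) le_rfl hsp hsp hbu hbu
    have h3 := BF.mul hb1 (by linarith) le_rfl hsp (hsp.mul hsp) hbu h2
    have h4 := BF.mul hb1 hm0 (min_le_left _ _) (hsp.mul (hsp.mul hsp)) hwsp.deriv h3
      (hw'.mono (min_le_right _ _))
    have hdu : ∀ i x, deriv (u i) x = (-1/2) * (u i x * (u i x * u i x) * deriv (fun x => (w i x : ℂ)) x) := by
      intro i x
      have hd : HasDerivAt (w i) (deriv (w i) x) x := ((hs i).differentiable (by simp) x).hasDerivAt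
      have d1 : deriv (fun x => (w i x : ℂ)) x = ((deriv (w i) x : ℝ) : ℂ) := hd.ofReal_comp.deriv
      have hsq := Real.sqrt_pos.mpr (hpos i x)
      have d2 := ((hd.sqrt (hpos i x).ne').inv hsq.ne').ofReal_comp.deriv
      rw [d1, hu]
      refine d2.trans ?_
      push_cast
      have : ((Real.sqrt (w i x) : ℝ) : ℂ) ≠ 0 := by exact_mod_cast hsq.ne'
      field_simp
    refine BF.up (F' := fun i => deriv (u i)) (fun i n => hsp.co_der i n) h0 ?_
    obtain ⟨K, hK, h⟩ := h4
    refine ⟨K, hK, fun i => ?_⟩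
    refine le_trans ?_ (h i)
    beta_reduce
    rw [show deriv (u i) = _ from funext (hdu i), SS, SS]
    apply ENNReal.tsum_le_tsum
    intro n
    rw [co_const_mul]
    gcongr
    rw [enorm_mul]
    refine mul_le_of_le_one_left' ?_
    rw [← ofReal_norm]
    rw [ENNReal.ofReal_le_one]
    norm_num
  have iter : ∀ k : ℕ, BF (min a (3/4 + k)) u := by
    intro k
    induction k with
    | zero =>
      simp only [Nat.cast_zero, add_zero]
      rw [min_eq_right (by linarith)]
      exact base _ (by norm_num) (by norm_num) (by linarith)
    | succ k ih =>
      have hk : (0:ℝ) ≤ k := Nat.cast_nonneg k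
      have := step _ (lt_min ha (by linarith)) (min_le_left _ _) ih
      refine this.mono ?_
      push_cast
      rw [← min_add_add_right]
      apply le_min
      · rw [← min_add_add_right]
        apply le_min
        · exact (min_le_left _ _).trans (by linarith)
        · exact (min_le_right _ _).trans (by linarith)
      · exact (min_le_left _ _).trans (by linarith)
  obtain ⟨k, hk⟩ := exists_nat_ge a
  have := iter k
  rwa [min_eq_left (by linarith)] at this

/-- composition -/
lemma BF_comp {r δ L : ℝ} (hr : 3/2 < r) (ψ ψ' φ : ℕ → ℝ → ℝ)
    (R : ∀ i, RepD (ψ i) (ψ' i) (φ i) δ L)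
    (hu : SP (fun i x => (((ψ' i x)⁻¹ : ℝ) : ℂ))) (hub : BF (r - 1) (fun i x => (((ψ' i x)⁻¹ : ℝ) : ℂ)))
    (k : ℕ) : ∀ b : ℝ, 0 ≤ b → b ≤ r → b < k + 1 → ∀ g : ℕ → ℝ → ℂ, SP g → BF b g →
      BF b (fun i x => g i (φ i x)) := by
  have low : ∀ b : ℝ, 0 ≤ b → b < 1 → ∀ g : ℕ → ℝ → ℂ, SP g → BF b g →
      BF b (fun i x => g i (φ i x)) := by
    intro b hb0 hb1 g hg hgb
    obtain ⟨C, hC, H⟩ := SS_comp_low hb0 hb1 δ L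
    obtain ⟨K, hK, h⟩ := hgb
    refine ⟨C * K, by finiteness, fun i => ?_⟩
    exact (H _ _ _ (R i) _ (hg.cont i)).trans (by gcongr; exact h i)
  induction k with
  | zero => intro b h0 _ h1; exact low b h0 (by simpa using h1)
  | succ k ih =>
    intro b h0 hbr hbk g hg hgb
    rcases lt_or_ge b 1 with h1 | h1
    · exact low b h0 h1 g hg hgb
    push_cast at hbk
    have hd : BF (b - 1) (fun i => deriv (g i)) := BF.deriv hg (by simpa using hgb)
    have hm := BF.mul (by linarith) (by linarith) (by linarith) hu hg.deriv hub hd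
    have := ih (b - 1) (by linarith) (by linarith) (by linarith) _ (hu.mul hg.deriv) hm
    have h2 := BF.up (F := fun i x => g i (φ i x)) (fun i n => (R i).co_der (g i) (deriv (g i)) (hg.hasDeriv i) (hg.deriv.cont i) (hg i).2 n)
      (low 0 le_rfl one_pos g hg (hgb.mono h0)) this
    simpa using h2

lemma co_trunc_le (M : ℕ) (g : ℝ → ℂ) (n : ℤ) : ‖co (trunc M g) n‖ₑ ≤ ‖co g n‖ₑ := by
  rw [co_trunc]; split_ifs <;> simp

lemma SS_trunc_le (b : ℝ) (M : ℕ) (g : ℝ → ℂ) : SS b (trunc M g) ≤ SS b g := by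
  unfold SS
  gcongr
  exact co_trunc_le _ _ _

lemma trunc_real (M : ℕ) (f : ℝ → ℝ) (x : ℝ) :
    (((trunc M (fun x => (f x : ℂ)) x).re : ℝ) : ℂ) = trunc M (fun x => (f x : ℂ)) x := by
  apply Complex.conj_eq_iff_re.mp
  unfold trunc
  rw [map_sum]
  refine Finset.sum_equiv (Equiv.neg ℤ) ?_ ?_
  · intro i; simp only [Finset.mem_Icc, Equiv.neg_apply]; omega
  · intro i _
    rw [map_mul, co_conj, ← Complex.exp_conj]
    have h2 : (starRingEnd ℂ) 2 = 2 := Complex.conj_ofNat 2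
    simp [h2]

lemma trunc_unif (g : ℝ → ℂ) (hg : Continuous g) (hp : Function.Periodic g 1)
    (hs : Summable (fun n => ‖co g n‖)) :
    TendstoUniformly (fun N : ℕ => trunc N g) g Filter.atTop := by
  have h := tendstoUniformly_tsum (f := fun (n : ℤ) (x : ℝ) => co g n *
    Complex.exp (2 * (Real.pi : ℂ) * Complex.I * (n : ℂ) * (x : ℂ))) hs
    (fun n x => by rw [norm_mul, norm_ex, mul_one])
  have e : (fun x : ℝ => ∑' n : ℤ, co g n *
    Complex.exp (2 * (Real.pi : ℂ) * Complex.I * (n : ℂ) * (x : ℂ))) = g :=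
    funext fun x => (expand g hg hp hs x).tsum_eq
  rw [e] at h
  have ht : Filter.Tendsto (fun N : ℕ => Finset.Icc (-(N:ℤ)) N) Filter.atTop Filter.atTop := by
    apply Filter.tendsto_atTop_finset_of_monotone
    · intro a b hab
      apply Finset.Icc_subset_Icc <;> simp [hab]
    · intro x
      refine ⟨x.natAbs, ?_⟩
      simp only [Finset.mem_Icc]; omega
  intro u hu
  exact ht.eventually (h u hu)

lemma exists_c1 {r : ℝ} (hr : 3/2 < r) (g : ℝ → ℂ) (hg : Continuous g) (hp : Function.Periodic g 1)
    (hS : SS r g ≠ ⊤) : ∃ g' : ℝ → ℂ, Continuous g' ∧ Function.Periodic g' 1 ∧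
      (∀ x, HasDerivAt g (g' x) x) ∧ SS (r - 1) g' ≠ ⊤ := by
  have hs := summable_co (a := r) (by linarith) g hS
  have hs1 : Summable (fun n : ℤ => 2 * Real.pi * |(n:ℝ)| * ‖co g n‖) := by
    have h := l1_le (a := r - 1) (fun n => jb 1 n * ‖co g n‖ₑ)
    have e : ∀ n, jb (r - 1) n * (jb 1 n * ‖co g n‖ₑ) = jb r n * ‖co g n‖ₑ := by
      intro n; rw [← mul_assoc, ← jb_add]; simp
    simp only [e] at h
    have h2 : (∑' n, jb 1 n * ‖co g n‖ₑ) ≠ ⊤ := by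
      intro htop
      rw [htop] at h
      have : (∑' n, jb (-(r-1)) n ^ 2) * SS r g < ⊤ :=
        ENNReal.mul_lt_top (jb_sum (by linarith)).lt_top hS.lt_top
      exact absurd (lt_of_le_of_lt h this) (by simp)
    have h3 := ENNReal.summable_toReal h2
    refine Summable.of_nonneg_of_le (fun n => by positivity) (fun n => ?_) (h3.mul_left (2 * Real.pi))
    rw [ENNReal.toReal_mul, jb, ENNReal.toReal_ofReal (by positivity), ← mul_assoc]
    simp only [toReal_enorm]
    gcongr
    rw [← Real.sqrt_eq_rpow]
    apply Real.le_sqrt_of_sq_le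
    simp
  set g' : ℝ → ℂ := fun x => ∑' n : ℤ, co g n * (Complex.exp (2 * (Real.pi : ℂ) * Complex.I * (n : ℂ) * (x : ℂ)) *
    (2 * (Real.pi : ℂ) * Complex.I * (n : ℂ))) with hg'
  have bd : ∀ (n : ℤ) (x : ℝ), ‖co g n * (Complex.exp (2 * (Real.pi : ℂ) * Complex.I * (n : ℂ) * (x : ℂ)) *
    (2 * (Real.pi : ℂ) * Complex.I * (n : ℂ)))‖ ≤ 2 * Real.pi * |(n:ℝ)| * ‖co g n‖ := by
    intro n x
    rw [norm_mul, norm_mul, norm_ex]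
    simp [abs_of_pos Real.pi_pos]
    apply le_of_eq; ring
  have hder : ∀ x, HasDerivAt g (g' x) x := by
    intro x
    have := hasDerivAt_tsum (g := fun (n : ℤ) (x : ℝ) => co g n *
      Complex.exp (2 * (Real.pi : ℂ) * Complex.I * (n : ℂ) * (x : ℂ))) hs1 (fun n y => by
        have h1 : HasDerivAt (fun y : ℝ => 2 * (Real.pi : ℂ) * Complex.I * (n : ℂ) * (y : ℂ))
          (2 * (Real.pi : ℂ) * Complex.I * (n : ℂ)) y := by
          simpa using (Complex.ofRealCLM.hasDerivAt (x := y)).const_mul (2 * (Real.pi : ℂ) * Complex.I * (n : ℂ))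
        exact h1.cexp.const_mul (co g n)) bd (y₀ := 0) (expand g hg hp hs 0).summable x
    have e : (fun x : ℝ => ∑' n : ℤ, co g n *
      Complex.exp (2 * (Real.pi : ℂ) * Complex.I * (n : ℂ) * (x : ℂ))) = g :=
      funext fun x => (expand g hg hp hs x).tsum_eq
    rw [e] at this
    exact this
  have hc : Continuous g' := continuous_tsum (fun n => by fun_prop) hs1 bd
  have hp' : Function.Periodic g' 1 := by
    intro x
    rw [← (hder x).deriv, ← (hder (x+1)).deriv]
    have : (fun y => g (y + 1)) = g := funext hp
    rw [← deriv_comp_add_const, this]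
  refine ⟨g', hc, hp', hder, ?_⟩
  have := SS_down (b := r - 1) g g' (co_deriv g g' hder hc (by simpa using hp 0))
  rw [sub_add_cancel] at this
  exact ne_top_of_le_ne_top (ENNReal.mul_ne_top ENNReal.ofReal_ne_top hS) this

/-- normalized primitive -/
def prim (v : ℝ → ℝ) (θ : ℝ) : ℝ := (∫ x in (0:ℝ)..1, v x)⁻¹ * ∫ x in (0:ℝ)..θ, v x

lemma int_bounds (v : ℝ → ℝ) (hv : Continuous v) (a b : ℝ)
    (lb : ∀ x, a ≤ v x) (ub : ∀ x, v x ≤ b) : a ≤ (∫ x in (0:ℝ)..1, v x) ∧ (∫ x in (0:ℝ)..1, v x) ≤ b := by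
  constructor
  · have := intervalIntegral.integral_mono_on (μ := volume) zero_le_one (f := fun _ => a) (g := v)
      (by simp) (hv.intervalIntegrable 0 1) (fun x _ => lb x)
    simpa using this
  · have := intervalIntegral.integral_mono_on (μ := volume) zero_le_one (g := fun _ => b) (f := v)
      (hv.intervalIntegrable 0 1) (by simp) (fun x _ => ub x)
    simpa using this

lemma rep_prim (v : ℝ → ℝ) (hv : Continuous v) (a b : ℝ) (ha : 0 < a)
    (lb : ∀ x, a ≤ v x) (ub : ∀ x, v x ≤ b) :
    RepD (prim v) (fun x => (∫ x in (0:ℝ)..1, v x)⁻¹ * v x) (Function.invFun (prim v)) (b⁻¹ * a) (a⁻¹ * b) := by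
  obtain ⟨h1, h2⟩ := int_bounds v hv a b lb ub
  set l := ∫ x in (0:ℝ)..1, v x with hl
  have hl0 : 0 < l := ha.trans_le h1
  have hb0 : 0 < b := hl0.trans_le h2
  have hder : ∀ x, HasDerivAt (prim v) (l⁻¹ * v x) x := by
    intro x
    exact (intervalIntegral.integral_hasDerivAt_right (hv.intervalIntegrable 0 x)
      (hv.stronglyMeasurableAtFilter _ _) hv.continuousAt).const_mul _
  have hlb : ∀ x, b⁻¹ * a ≤ l⁻¹ * v x := fun x => by
    have := lb x
    gcongr
  have hub : ∀ x, l⁻¹ * v x ≤ a⁻¹ * b := fun x => by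
    have := ub x
    have := (ha.trans_le (lb x)).le
    gcongr
  have hd : 0 < b⁻¹ * a := by positivity
  have hmono : StrictMono (prim v) := strictMono_of_deriv_pos (fun x => by
    rw [(hder x).deriv]; exact hd.trans_le (hlb x))
  have hcont : Continuous (prim v) := continuous_iff_continuousAt.mpr fun x => (hder x).continuousAt
  have hz : prim v 0 = 0 := by simp [prim]
  have hmon : Monotone (fun x => prim v x - b⁻¹ * a * x) := by
    have hdd : ∀ x, HasDerivAt (fun x => prim v x - b⁻¹ * a * x) (l⁻¹ * v x - b⁻¹ * a) x := by
      intro x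
      have h3 : HasDerivAt (fun x : ℝ => b⁻¹ * a * x) (b⁻¹ * a) x := by
        simpa using (hasDerivAt_id x).const_mul (b⁻¹ * a)
      exact (hder x).sub h3
    apply monotone_of_deriv_nonneg (fun x => (hdd x).differentiableAt)
    intro x
    rw [(hdd x).deriv]
    linarith [hlb x]
  have hsurj : Function.Surjective (prim v) := by
    apply hcont.surjective
    · apply Filter.tendsto_atTop_mono' _ _ (Filter.tendsto_id.const_mul_atTop hd)
      filter_upwards [Filter.eventually_ge_atTop 0] with x hx
      have := hmon hx
      simp only [hz] at this
      simp; linarith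
    · apply Filter.tendsto_atBot_mono' _ _ (Filter.tendsto_id.const_mul_atBot hd)
      filter_upwards [Filter.eventually_le_atBot 0] with x hx
      have := hmon hx
      simp only [hz] at this
      simp; linarith
  have hleft : ∀ x, Function.invFun (prim v) (prim v x) = x := Function.leftInverse_invFun hmono.injective
  have hright : ∀ x, prim v (Function.invFun (prim v) x) = x := Function.rightInverse_invFun hsurj
  refine ⟨hder, by fun_prop, hz, ?_, ?_, hleft, hright, hd, hlb, hub⟩
  · rw [prim, inv_mul_cancel₀ hl0.ne']
  · have e : Function.invFun (prim v) = (hmono.orderIsoOfSurjective _ hsurj).symm := by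
      ext x
      apply hmono.injective
      rw [hright]
      exact ((hmono.orderIsoOfSurjective _ hsurj).apply_symm_apply x).symm
    rw [e]
    exact OrderIso.continuous _

lemma BF.add {F G : ℕ → ℝ → ℂ} {b : ℝ} (hF : SP F) (hG : SP G) (h : BF b F) (h' : BF b G) :
    BF b (fun i x => F i x + G i x) := by
  obtain ⟨K, hK, h⟩ := h
  obtain ⟨K', hK', h'⟩ := h'
  refine ⟨4 * (K + K'), by finiteness, fun i => ?_⟩
  calc SS b (fun x => F i x + G i x) ≤ 4 * (SS b (F i) + SS b (G i)) := by
        rw [SS, SS, SS, ← ENNReal.tsum_add, ← ENNReal.tsum_mul_left]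
        apply ENNReal.tsum_le_tsum
        intro n
        refine le_trans ?_ (add_sq_le4 _ _)
        rw [co_add _ _ (hF.cont i).continuousOn (hG.cont i).continuousOn, ← mul_add]
        gcongr
        exact enorm_add_le _ _
    _ ≤ _ := by gcongr; exacts [h i, h' i]

lemma BF_sum {ι : Type*} (s : Finset ι) (F : ι → ℕ → ℝ → ℂ) {b : ℝ} (hF : ∀ j, SP (F j))
    (h : ∀ j, BF b (F j)) : SP (fun i x => ∑ j ∈ s, F j i x) ∧ BF b (fun i x => ∑ j ∈ s, F j i x) := by
  classical
  induction s using Finset.induction_on with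
  | empty =>
    refine ⟨fun i => ⟨by simpa using contDiff_const, fun x => by simp⟩, 0, by simp, fun i => ?_⟩
    simp [SS, co]
  | insert j s hj ih =>
    simp only [Finset.sum_insert hj]
    refine ⟨fun i => ⟨(hF j i).1.add (ih.1 i).1, fun x => ?_⟩, BF.add (hF j) ih.1 (h j) ih.2⟩
    have := (ih.1 i).2 x
    beta_reduce at this ⊢
    rw [this, (hF j i).2 x]

lemma BF_const_mul {F : ℕ → ℝ → ℂ} {b B : ℝ} (a : ℕ → ℝ) (ha : ∀ i, |a i| ≤ B) (hF : SP F) (h : BF b F) :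
    SP (fun i x => (a i : ℂ) * F i x) ∧ BF b (fun i x => (a i : ℂ) * F i x) := by
  refine ⟨fun i => ⟨contDiff_const.mul (hF i).1, fun x => by simp only [(hF i).2 x]⟩, ?_⟩
  obtain ⟨K, hK, h⟩ := h
  refine ⟨ENNReal.ofReal B ^ 2 * K, by finiteness, fun i => ?_⟩
  refine le_trans ?_ (mul_le_mul_right (h i) _)
  rw [SS, SS, ← ENNReal.tsum_mul_left]
  apply ENNReal.tsum_le_tsum
  intro n
  rw [co_const_mul, enorm_mul, ← mul_pow, mul_left_comm]
  gcongr
  rw [← ofReal_norm, Complex.norm_real]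
  exact ENNReal.ofReal_le_ofReal (ha i)

lemma SP_trunc (N : ℕ → ℕ) (g : ℝ → ℂ) : SP (fun i => trunc (N i) g) :=
  fun i => ⟨trunc_contDiff _ _ _, trunc_periodic _ _⟩
lemma BF_trunc (b : ℝ) (N : ℕ → ℕ) (g : ℝ → ℂ) (h : SS b g ≠ ⊤) : BF b (fun i => trunc (N i) g) :=
  ⟨_, h, fun i => SS_trunc_le _ _ _⟩

lemma SS_fatou (b : ℝ) (f : ℝ → ℂ) (F : ℕ → ℝ → ℂ) (h : BF b F)
    (hc : ∀ n, Filter.Tendsto (fun i => co (F i) n) Filter.atTop (nhds (co f n))) : SS b f ≠ ⊤ := by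
  obtain ⟨K, hK, h⟩ := h
  refine ne_top_of_le_ne_top hK ?_
  rw [SS, ENNReal.tsum_eq_iSup_sum]
  apply iSup_le
  intro s
  have ht : Filter.Tendsto (fun i => ∑ n ∈ s, (jb b n * ‖co (F i) n‖ₑ) ^ 2) Filter.atTop
      (nhds (∑ n ∈ s, (jb b n * ‖co f n‖ₑ) ^ 2)) := by
    apply tendsto_finsetSum
    intro n _
    apply ENNReal.Tendsto.pow
    apply ENNReal.Tendsto.const_mul (hc n).enorm
    right; exact jb_top _ _
  apply le_of_tendsto' ht
  intro i
  exact (ENNReal.sum_le_tsum s).trans (h i)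

lemma comp_main {d : ℕ} {r : ℝ} (hr : 3/2 < r) (V : ℝ → EuclideanSpace ℝ (Fin d)) (hV : Continuous V)
    (hVp : Function.Periodic V 1) (hVS : ∀ j, SS (r - 1) (fun x => ((V x j : ℝ) : ℂ)) ≠ ⊤)
    (hV0 : ∀ x, V x ≠ 0) (h : ℝ → ℂ) (hh : Continuous h) (hhp : Function.Periodic h 1)
    (hS : SS r h ≠ ⊤) :
    (∃ δ L, RepD (prim (fun x => ‖V x‖)) (fun x => (∫ x in (0:ℝ)..1, ‖V x‖)⁻¹ * ‖V x‖)
      (Function.invFun (prim (fun x => ‖V x‖))) δ L) ∧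
    SS r (fun x => h (Function.invFun (prim (fun x => ‖V x‖)) x)) ≠ ⊤ := by
  -- bounds for V
  have hred : ∀ x, ∃ y ∈ Set.Icc (0:ℝ) 1, V x = V y := by
    intro x
    refine ⟨Int.fract x, ⟨Int.fract_nonneg x, (Int.fract_lt_one x).le⟩, ?_⟩
    have := hVp.sub_int_mul_eq (x := x) ⌊x⌋
    rw [mul_one] at this
    exact this.symm
  obtain ⟨x0, -, hx0⟩ := isCompact_Icc.exists_isMinOn (Set.nonempty_Icc.mpr (zero_le_one' ℝ))
    (hV.norm.continuousOn)
  obtain ⟨B, hB⟩ := isCompact_Icc.exists_bound_of_continuousOn (hV.continuousOn (s := Set.Icc 0 1))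
  set m := ‖V x0‖ with hm
  have hm0 : 0 < m := norm_pos_iff.mpr (hV0 x0)
  have Vlb : ∀ x, m ≤ ‖V x‖ := by
    intro x
    obtain ⟨y, hy, e⟩ := hred x
    rw [e]; exact hx0 hy
  have Vub : ∀ x, ‖V x‖ ≤ B := by
    intro x
    obtain ⟨y, hy, e⟩ := hred x
    rw [e]; exact hB y hy
  have R := rep_prim (fun x => ‖V x‖) hV.norm m B hm0 Vlb Vub
  refine ⟨⟨_, _, R⟩, ?_⟩
  -- approximations
  set Vj : Fin d → ℝ → ℂ := fun j x => ((V x j : ℝ) : ℂ) with hVj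
  have Vjc : ∀ j, Continuous (Vj j) := fun j => by
    have : Continuous fun x => V x j := (EuclideanSpace.proj (𝕜 := ℝ) j).continuous.comp hV
    exact Complex.continuous_ofReal.comp this
  have Vjp : ∀ j, Function.Periodic (Vj j) 1 := fun j x => by simp only [hVj, hVp x]
  have Vju : ∀ j, TendstoUniformly (fun N : ℕ => trunc N (Vj j)) (Vj j) Filter.atTop := fun j =>
    trunc_unif _ (Vjc j) (Vjp j) (summable_co (a := r - 1) (by linarith) _ (hVS j))
  have hu : TendstoUniformly (fun N : ℕ => trunc N h) h Filter.atTop :=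
    trunc_unif _ hh hhp (summable_co (a := r) (by linarith) _ hS)
  set W : ℕ → ℝ → EuclideanSpace ℝ (Fin d) := fun N x => WithLp.toLp 2 (fun j => (trunc N (Vj j) x).re) with hW
  have Wj : ∀ N x j, ((W N x j : ℝ) : ℂ) = trunc N (Vj j) x := fun N x j => trunc_real N (fun x => V x j) x
  have Wdist : ∀ ε > 0, ∀ᶠ N in Filter.atTop, ∀ x, ‖W N x - V x‖ < ε := by
    intro ε hε
    have hε' : 0 < ε / (d + 1) := by positivity
    have : ∀ᶠ N in Filter.atTop, ∀ j x, dist (Vj j x) (trunc N (Vj j) x) < ε / (d + 1) :=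
      Filter.eventually_all.mpr fun j => Metric.tendstoUniformly_iff.mp (Vju j) _ hε'
    filter_upwards [this] with N hN x
    calc ‖W N x - V x‖ ≤ ∑ j : Fin d, ‖(W N x - V x) j‖ := by
          have e := EuclideanSpace.basisFun (Fin d) ℝ
          rw [← abs_of_nonneg (norm_nonneg (W N x - V x)), ← abs_of_nonneg
            (Finset.sum_nonneg (fun j _ => norm_nonneg ((W N x - V x) j)) : (0:ℝ) ≤ ∑ j : Fin d, ‖(W N x - V x) j‖),
            ← sq_le_sq, EuclideanSpace.norm_sq_eq]
          exact Finset.sum_sq_le_sq_sum_of_nonneg fun j _ => norm_nonneg _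
      _ ≤ ∑ j : Fin d, ε / (d + 1) := by
          apply Finset.sum_le_sum
          intro j _
          have := (hN j x).le
          rw [dist_comm, dist_eq_norm, ← Wj, hVj, ← Complex.ofReal_sub, Complex.norm_real] at this
          exact this
      _ < ε := by
          simp
          rw [mul_div_assoc', div_lt_iff₀ (by positivity)]
          nlinarith
  obtain ⟨N0, hN0⟩ := Filter.eventually_atTop.mp ((Wdist (m / 2) (by positivity)).and
    ((Metric.tendstoUniformly_iff.mp hu) 1 one_pos))
  set v : ℕ → ℝ → ℝ := fun i x => ‖W (i + N0) x‖ with hv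
  have vlb : ∀ i x, m / 2 ≤ v i x := by
    intro i x
    have h1 := (hN0 (i + N0) (by omega)).1 x
    have h2 := Vlb x
    have h3 := norm_sub_norm_le (V x) (W (i+N0) x)
    rw [norm_sub_rev] at h3
    simp only [hv]; linarith
  have vub : ∀ i x, v i x ≤ B + m / 2 := by
    intro i x
    have h1 := (hN0 (i + N0) (by omega)).1 x
    have h2 := Vub x
    have h3 := norm_sub_norm_le (W (i+N0) x) (V x)
    simp only [hv]; linarith
  have Wc : ∀ N, Continuous (W N) := by
    intro N
    refine (PiLp.continuous_toLp 2 _).comp (continuous_pi fun j => ?_)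
    exact Complex.continuous_re.comp (trunc_contDiff N (Vj j) 0).continuous
  have vc : ∀ i, Continuous (v i) := fun i => (Wc _).norm
  have RN := fun i => rep_prim (v i) (vc i) (m/2) (B + m/2) (by positivity) (vlb i) (vub i)
  -- smoothness and bounds
  set w : ℕ → ℝ → ℝ := fun i x => ∑ j : Fin d, (trunc (i + N0) (Vj j) x).re ^ 2 with hw
  have hwv : ∀ i x, v i x = Real.sqrt (w i x) := by
    intro i x
    rw [hv, hw]
    simp only [EuclideanSpace.norm_eq]
    simp [hW]
  have hws : ∀ i, ContDiff ℝ (⊤ : ℕ∞) (w i) := by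
    intro i
    apply ContDiff.sum
    intro j _
    apply ContDiff.pow
    exact Complex.reCLM.contDiff.comp (trunc_contDiff _ _ _)
  have hwp : ∀ i, Function.Periodic (w i) 1 := by
    intro i x
    simp only [hw, trunc_periodic _ _ x]
  have hwlb : ∀ i x, (m / 2) ^ 2 ≤ w i x := by
    intro i x
    have h1 := vlb i x
    rw [hwv] at h1
    exact (Real.le_sqrt' (by positivity)).mp h1
  have hsp : ∀ j, SP (fun i => trunc (i + N0) (Vj j)) := fun j => SP_trunc _ _
  have hbf : ∀ j, BF (r - 1) (fun i => trunc (i + N0) (Vj j)) := fun j => BF_trunc _ _ _ (hVS j)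
  have hwbf : BF (r - 1) (fun i x => (w i x : ℂ)) := by
    have := (BF_sum Finset.univ (fun j i x => trunc (i + N0) (Vj j) x * trunc (i + N0) (Vj j) x)
      (fun j => (hsp j).mul (hsp j))
      (fun j => BF.mul (by linarith) (by linarith) le_rfl (hsp j) (hsp j) (hbf j) (hbf j))).2
    convert this using 4 with i x
    simp only [hw]
    push_cast
    congr 1; ext j
    rw [sq, trunc_real (i + N0) (fun x => V x j) x]
  have hU := BF_invsqrt (by linarith) (by positivity) w hws hwp hwlb hwbf
  have lN := fun i => int_bounds (v i) (vc i) _ _ (vlb i) (vub i)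
  have hU2 := BF_const_mul (fun i => ∫ x in (0:ℝ)..1, v i x) (B := B + m / 2) (fun i => by
    rw [abs_of_nonneg (by linarith [(lN i).1])]; exact (lN i).2) hU.1 hU.2
  have hUe : (fun i x => (((fun x => (∫ x in (0:ℝ)..1, v i x)⁻¹ * v i x) x)⁻¹ : ℝ) : ℕ → ℝ → ℝ) =
      fun i x => (∫ x in (0:ℝ)..1, v i x) * (Real.sqrt (w i x))⁻¹ := by
    ext i x
    simp only [mul_inv, inv_inv, hwv]
  have hUe' : (fun (i : ℕ) (x : ℝ) => ((((fun x => (∫ x in (0:ℝ)..1, v i x)⁻¹ * v i x) x)⁻¹ : ℝ) : ℂ)) =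
      fun i x => ((∫ x in (0:ℝ)..1, v i x : ℝ) : ℂ) * (((Real.sqrt (w i x))⁻¹ : ℝ) : ℂ) := by
    ext i x
    rw [← Complex.ofReal_mul]
    exact congrArg _ (congrFun (congrFun hUe i) x)
  rw [← hUe'] at hU2
  obtain ⟨k, hk⟩ := exists_nat_ge r
  have hfin := BF_comp hr _ _ _ RN hU2.1 hU2.2 k r (by linarith) le_rfl (by linarith)
    (fun i => trunc (i + N0) h) (SP_trunc _ _) (BF_trunc _ _ _ hS)
  refine SS_fatou r _ _ hfin ?_
  -- convergence of coefficients
  intro n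
  have hvt : ∀ x, Filter.Tendsto (fun i => v i x) Filter.atTop (nhds ‖V x‖) := by
    intro x
    have h1 : Filter.Tendsto (fun N => W N x) Filter.atTop (nhds (V x)) := by
      rw [Metric.tendsto_nhds]
      intro ε hε
      filter_upwards [Wdist ε hε] with N hN
      rw [dist_eq_norm]; exact hN x
    exact ((Filter.tendsto_add_atTop_iff_nat N0).mpr h1).norm
  have hit : ∀ y, Filter.Tendsto (fun i => ∫ x in (0:ℝ)..y, v i x) Filter.atTop
      (nhds (∫ x in (0:ℝ)..y, ‖V x‖)) := by
    intro y
    apply intervalIntegral.tendsto_integral_filter_of_dominated_convergence (fun _ => B + m / 2)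
    · exact Filter.Eventually.of_forall fun i => (vc i).aestronglyMeasurable
    · refine Filter.Eventually.of_forall fun i => Filter.Eventually.of_forall fun x _ => ?_
      rw [Real.norm_of_nonneg (norm_nonneg _)]
      exact vub i x
    · simp
    · exact Filter.Eventually.of_forall fun x _ => hvt x
  have hl : (∫ x in (0:ℝ)..1, ‖V x‖) ≠ 0 := by
    have := (int_bounds _ hV.norm m B Vlb Vub).1
    linarith
  have hlt := (hit 1).inv₀ hl
  have hpt : ∀ y, Filter.Tendsto (fun i => prim (v i) y) Filter.atTop
      (nhds (prim (fun x => ‖V x‖) y)) := fun y => hlt.mul (hit y)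
  have hht : ∀ x, Filter.Tendsto (fun i => trunc (i + N0) h x) Filter.atTop (nhds (h x)) := fun x =>
    (Filter.tendsto_add_atTop_iff_nat N0 (f := fun N => trunc N h x)).mpr (hu.tendsto_at x)
  obtain ⟨H, hH⟩ := isCompact_Icc.exists_bound_of_continuousOn (hh.continuousOn (s := Set.Icc 0 1))
  rw [R.co_comp h hh n]
  have hce : ∀ i, co (fun x => trunc (i + N0) h (Function.invFun (prim (v i)) x)) n = _ :=
    fun i => (RN i).co_comp (trunc (i + N0) h) (trunc_contDiff _ _ 0).continuous n
  simp only [hce]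
  apply intervalIntegral.tendsto_integral_filter_of_dominated_convergence
    (fun _ => ((m/2)⁻¹ * (B + m / 2)) * (H + 1))
  · refine Filter.Eventually.of_forall fun i => ?_
    have c1 := (RN i).cont'
    have c2 := (RN i).cpsi
    have c3 : Continuous (trunc (i + N0) h) := (trunc_contDiff _ _ 0).continuous
    apply Continuous.aestronglyMeasurable
    fun_prop
  · refine Filter.Eventually.of_forall fun i => Filter.Eventually.of_forall fun x hx => ?_
    rw [Set.uIoc_of_le zero_le_one] at hx
    rw [norm_smul, norm_mul (Complex.exp _), norm_ex_neg, one_mul, Real.norm_of_nonneg ((RN i).pos x).le]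
    have h1 := (RN i).ub x
    have h0 := (RN i).pos x
    have h2 := (hN0 (i + N0) (by omega)).2 x
    have h3 := hH x ⟨hx.1.le, hx.2⟩
    rw [dist_eq_norm] at h2
    have h4 := norm_sub_norm_le (trunc (i + N0) h x) (h x)
    rw [norm_sub_rev] at h4
    have h5 : ‖trunc (i + N0) h x‖ ≤ H + 1 := by linarith
    have h6 := h0.le.trans h1
    gcongr
  · simp
  · refine Filter.Eventually.of_forall fun x _ => ?_
    refine (hlt.mul (hvt x)).smul (Filter.Tendsto.mul ?_ (hht x))
    refine (Complex.continuous_exp.tendsto _).comp ?_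
    apply Filter.Tendsto.const_mul
    exact (Complex.continuous_ofReal.tendsto _).comp (hpt x)

lemma ker_sum {q : ℝ} (hq : 1/2 < q) : ∃ A : ℝ, 0 < A ∧ ∀ ρ : ℝ, 0 < ρ → ρ ≤ 1 →
    ∑' n : ℤ, ENNReal.ofReal ((1 + (ρ * |(n:ℝ)|) ^ (2 * q))⁻¹) ≤ ENNReal.ofReal (A / ρ) := by
  set b : ℤ → ℝ := fun k => (1 + (max (|(k:ℝ)| - 1) 0) ^ (2 * q))⁻¹ with hb
  have hb0 : ∀ k, 0 ≤ b k := fun k => by simp only [hb]; positivity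
  have hs : Summable b := by
    have h1 := (Real.summable_abs_int_rpow (b := 2 * q) (by linarith)).mul_left (2 ^ (2 * q))
    refine Summable.of_norm_bounded_eventually h1 ?_
    have hfin : (Set.Icc (-1:ℤ) 1).Finite := Set.finite_Icc _ _
    filter_upwards [hfin.compl_mem_cofinite] with k hk
    have hk2 : 2 ≤ |k| := by
      simp only [Set.mem_compl_iff, Set.mem_Icc] at hk
      by_contra hc
      apply hk
      rw [← abs_le]
      omega
    have hk3 : (2:ℝ) ≤ |(k:ℝ)| := by exact_mod_cast hk2
    rw [Real.norm_of_nonneg (hb0 k), hb]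
    simp only
    rw [max_eq_left (by linarith), Real.rpow_neg (by positivity), ← inv_inv ((2:ℝ) ^ (2 * q)), ← mul_inv]
    apply inv_anti₀ (by positivity)
    rw [← Real.inv_rpow (by norm_num), ← Real.mul_rpow (by norm_num) (by positivity)]
    have : (2⁻¹ * |(k:ℝ)|) ^ (2 * q) ≤ (|(k:ℝ)| - 1) ^ (2 * q) := by
      apply Real.rpow_le_rpow (by positivity) (by linarith) (by linarith)
    linarith
  have hA0 : 0 ≤ ∑' k, b k := tsum_nonneg hb0
  refine ⟨2 * ((∑' k, b k) + 1), by positivity, ?_⟩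
  intro ρ h0 h1
  set M : ℕ := ⌈1 / ρ⌉₊ with hM
  have hρ1 : 1 ≤ 1 / ρ := by rw [le_div_iff₀ h0]; linarith
  have hMl : 1 / ρ ≤ M := Nat.le_ceil _
  have hMu : (M:ℝ) ≤ 2 / ρ := by
    have := (Nat.ceil_lt_add_one (by positivity : 0 ≤ 1 / ρ)).le
    calc (M:ℝ) ≤ 1 / ρ + 1 := this
      _ ≤ 1 / ρ + 1 / ρ := by linarith
      _ = _ := by ring
  have hM0 : M ≠ 0 := by
    intro h
    rw [h] at hMl
    simp at hMl
    linarith [inv_pos.mpr h0]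
  haveI : NeZero M := ⟨hM0⟩
  have hMρ : 1 ≤ ρ * M := by
    rw [div_le_iff₀ h0] at hMl; linarith
  rw [← (Int.divModEquiv M).symm.tsum_eq, ENNReal.tsum_prod']
  calc _ ≤ ∑' (a : ℤ), ∑' (j : Fin M), ENNReal.ofReal (b a) := by
        apply ENNReal.tsum_le_tsum
        intro k
        apply ENNReal.tsum_le_tsum
        intro j
        apply ENNReal.ofReal_le_ofReal
        simp only [hb]
        apply inv_anti₀ (by positivity)
        gcongr
        apply max_le _ (by positivity)
        have e : (((Int.divModEquiv M).symm (k, j) : ℤ) : ℝ) = (k:ℝ) * M + (j:ℕ) := by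
          simp [Int.divModEquiv]
          try ring
        rw [e]
        have hj : ((j:ℕ):ℝ) ≤ M := by exact_mod_cast j.2.le
        have hj0 : (0:ℝ) ≤ (j:ℕ) := by positivity
        have t : |(k:ℝ)| * M ≤ |(k:ℝ) * M + (j:ℕ)| + M := by
          have t1 := abs_sub ((k:ℝ) * M + (j:ℕ)) (j:ℕ)
          rw [add_sub_cancel_right, abs_mul, Nat.abs_cast, Nat.abs_cast] at t1
          linarith
        rcases le_total (|(k:ℝ)| - 1) 0 with hneg | hpos
        · exact hneg.trans (by positivity)
        · calc |(k:ℝ)| - 1 ≤ (|(k:ℝ)| - 1) * (ρ * M) := le_mul_of_one_le_right hpos hMρ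
            _ = ρ * (|(k:ℝ)| * M - M) := by ring
            _ ≤ _ := by gcongr; linarith
    _ = M * ∑' a, ENNReal.ofReal (b a) := by
        rw [← ENNReal.tsum_mul_left]
        congr 1; ext a
        rw [tsum_fintype]
        simp
    _ = ENNReal.ofReal (M * ∑' a, b a) := by
        rw [ENNReal.ofReal_mul (by positivity), ENNReal.ofReal_tsum_of_nonneg hb0 hs]
        simp
    _ ≤ _ := by
        apply ENNReal.ofReal_le_ofReal
        calc (M:ℝ) * ∑' a, b a ≤ (2 / ρ) * ((∑' a, b a) + 1) := by gcongr; linarith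
          _ = _ := by ring

lemma scalar_bound {q A : ℝ} (hq : 1/2 < q) (hA0 : 0 < A) (hA : ∀ ρ : ℝ, 0 < ρ → ρ ≤ 1 →
    ∑' n : ℤ, ENNReal.ofReal ((1 + (ρ * |(n:ℝ)|) ^ (2 * q))⁻¹) ≤ ENNReal.ofReal (A / ρ))
    (f : ℝ → ℂ) (hf : Continuous f) (hp : Function.Periodic f 1) (hS : SS q f ≠ ⊤) :
    Summable (fun n : ℤ => |(n:ℝ)| ^ (2 * q) * ‖co f n‖ ^ 2) ∧ ∀ ρ : ℝ, 0 < ρ → ρ ≤ 1 → ∀ x,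
      ‖f x‖ ^ 2 ≤ (A / ρ) * ((∫ x in (0:ℝ)..1, ‖f x‖ ^ 2) +
        ρ ^ (2 * q) * ∑' n : ℤ, |(n:ℝ)| ^ (2 * q) * ‖co f n‖ ^ 2) := by
  have hco := summable_co hq f hS
  have hH : HS q f ≠ ⊤ := ne_top_of_le_ne_top hS (HS_le_SS (by linarith) f)
  have hsum : Summable (fun n : ℤ => |(n:ℝ)| ^ (2 * q) * ‖co f n‖ ^ 2) := by
    have := ENNReal.summable_toReal hH
    refine this.congr fun n => ?_
    rw [ENNReal.toReal_mul, ENNReal.toReal_ofReal (by positivity), ENNReal.toReal_pow, toReal_enorm]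
  refine ⟨hsum, ?_⟩
  intro ρ h0 h1 x
  have hpar := plancherel f hf.continuousOn
  have hs2 : HasSum (fun n : ℤ => (1 + (ρ * |(n:ℝ)|) ^ (2 * q)) * ‖co f n‖ ^ 2)
      ((∫ x in (0:ℝ)..1, ‖f x‖ ^ 2) + ρ ^ (2 * q) * ∑' n : ℤ, |(n:ℝ)| ^ (2 * q) * ‖co f n‖ ^ 2) := by
    convert hpar.add (hsum.hasSum.mul_left (ρ ^ (2 * q))) using 2 with n
    rw [Real.mul_rpow h0.le (abs_nonneg _)]; ring
  have hx : ‖f x‖ₑ ≤ ∑' n, ‖co f n‖ₑ := by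
    have he := expand f hf hp hco x
    rw [← he.tsum_eq]
    refine (enorm_tsum_le_tsum_enorm).trans (le_of_eq ?_)
    congr 1; ext n
    rw [enorm_mul]
    have : ‖Complex.exp (2 * (Real.pi : ℂ) * Complex.I * (n : ℂ) * (x : ℂ))‖ₑ = 1 := by
      rw [← ofReal_norm, norm_ex]; simp
    rw [this, mul_one]
  have key : ENNReal.ofReal (‖f x‖ ^ 2) ≤ ENNReal.ofReal ((A / ρ) * ((∫ x in (0:ℝ)..1, ‖f x‖ ^ 2) +
        ρ ^ (2 * q) * ∑' n : ℤ, |(n:ℝ)| ^ (2 * q) * ‖co f n‖ ^ 2)) := by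
    rw [ENNReal.ofReal_pow (norm_nonneg _), ofReal_norm]
    calc ‖f x‖ₑ ^ 2 ≤ (∑' n, ‖co f n‖ₑ) ^ 2 := by gcongr
      _ = (∑' n : ℤ, ENNReal.ofReal (Real.sqrt (1 + (ρ * |(n:ℝ)|) ^ (2 * q))⁻¹) *
            (ENNReal.ofReal (Real.sqrt (1 + (ρ * |(n:ℝ)|) ^ (2 * q))) * ‖co f n‖ₑ)) ^ 2 := by
          congr 2; ext n
          rw [← mul_assoc, ← ENNReal.ofReal_mul (by positivity), Real.sqrt_inv, inv_mul_cancel₀ (by positivity)]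
          simp
      _ ≤ _ := cs_tsum _ _
      _ = (∑' n : ℤ, ENNReal.ofReal ((1 + (ρ * |(n:ℝ)|) ^ (2 * q))⁻¹)) *
           ∑' n : ℤ, ENNReal.ofReal ((1 + (ρ * |(n:ℝ)|) ^ (2 * q)) * ‖co f n‖ ^ 2) := by
          congr 2
          · ext n
            rw [← ENNReal.ofReal_pow (by positivity), Real.sq_sqrt (by positivity)]
          · ext n
            rw [mul_pow, ← ENNReal.ofReal_pow (by positivity), Real.sq_sqrt (by positivity),
              ENNReal.ofReal_mul (by positivity), ENNReal.ofReal_pow (norm_nonneg _), ofReal_norm]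
      _ ≤ _ := by
          rw [ENNReal.ofReal_mul (by positivity), ← hs2.tsum_eq,
            ENNReal.ofReal_tsum_of_nonneg (fun n => by positivity) hs2.summable]
          gcongr
          exact hA ρ h0 h1
  refine (ENNReal.ofReal_le_ofReal_iff ?_).mp key
  have : 0 ≤ ((∫ x in (0:ℝ)..1, ‖f x‖ ^ 2) +
        ρ ^ (2 * q) * ∑' n : ℤ, |(n:ℝ)| ^ (2 * q) * ‖co f n‖ ^ 2) :=
    hs2.nonneg (fun n => by positivity)
  positivity

lemma SS_of_summable {d : ℕ} {r : ℝ} (f : ℝ → Edim d)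
    (hs : Summable (fun n : ℤ => (1 + (n : ℝ) ^ 2) ^ r * coeffNormSq f n)) (j : Fin d) :
    SS r (fun x => ((f x j : ℝ) : ℂ)) ≠ ⊤ := by
  have h1 : Summable (fun n : ℤ => (1 + (n : ℝ) ^ 2) ^ r * ‖co (fun x => ((f x j : ℝ) : ℂ)) n‖ ^ 2) := by
    refine Summable.of_nonneg_of_le (fun n => by positivity) (fun n => ?_) hs
    gcongr
    exact Finset.single_le_sum (f := fun i => ‖fCoeff (fun θ => f θ i) n‖ ^ 2)
      (fun i _ => by positivity) (Finset.mem_univ j)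
  have h2 := h1.tsum_ofReal_ne_top
  unfold SS
  convert h2 using 3 with n
  rw [mul_pow, jb_sq, ENNReal.ofReal_mul (by positivity), ENNReal.ofReal_pow (norm_nonneg _), ofReal_norm]

lemma deriv_of_sob {d : ℕ} {r : ℝ} (hr : 3/2 < r) (c : ℝ → Edim d) (hc : c ∈ SobImm d r) :
    Continuous (deriv c) ∧ Function.Periodic (deriv c) 1 ∧
      ∀ j, SS (r - 1) (fun x => ((deriv c x j : ℝ) : ℂ)) ≠ ⊤ := by
  obtain ⟨hp, hcc, hs, -⟩ := hc
  have hj : ∀ j, Continuous (fun x => c x j) := fun j =>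
    (EuclideanSpace.proj (𝕜 := ℝ) j).continuous.comp hcc
  have := fun j => exists_c1 hr (fun x => ((c x j : ℝ) : ℂ)) (Complex.continuous_ofReal.comp (hj j))
    (fun x => by simp only [hp x]) (SS_of_summable c hs j)
  choose g' hg1 hg2 hg3 hg4 using this
  have hre : ∀ j x, HasDerivAt (fun x => c x j) (g' j x).re x := fun j x =>
    Complex.reCLM.hasFDerivAt.comp_hasDerivAt x (hg3 j x)
  have hgr : ∀ j x, (((g' j x).re : ℝ) : ℂ) = g' j x := fun j x =>
    (hre j x).ofReal_comp.unique (hg3 j x)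
  have hd : ∀ x, HasDerivAt c (WithLp.toLp 2 (fun j => (g' j x).re)) x := by
    intro x
    have h1 : HasDerivAt (fun x j => c x j) (fun j => (g' j x).re) x := hasDerivAt_pi.mpr fun j => hre j x
    exact (PiLp.continuousLinearEquiv 2 ℝ (fun _ : Fin d => ℝ)).symm.hasFDerivAt.comp_hasDerivAt x h1
  have hde : deriv c = fun x => WithLp.toLp 2 (fun j => (g' j x).re) := funext fun x => (hd x).deriv
  rw [hde]
  refine ⟨?_, ?_, ?_⟩
  · exact (PiLp.continuous_toLp 2 _).comp (continuous_pi fun j => Complex.continuous_re.comp (hg1 j))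
  · intro x; simp only [hg2 _ x]
  · intro j
    have : (fun x => (((WithLp.toLp 2 (fun j => (g' j x).re) : Edim d) j : ℝ) : ℂ)) = g' j :=
      funext fun x => hgr j x
    rw [this]; exact hg4 j

lemma prim_add_one (v : ℝ → ℝ) (hv : Continuous v) (hp : Function.Periodic v 1)
    (hl : (∫ x in (0:ℝ)..1, v x) ≠ 0) (x : ℝ) : prim v (x + 1) = prim v x + 1 := by
  have h1 := intervalIntegral.integral_add_adjacent_intervals (hv.intervalIntegrable 0 x (μ := volume))
    (hv.intervalIntegrable x (x + 1))
  have h2 := hp.intervalIntegral_add_eq x 0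
  rw [zero_add] at h2
  rw [prim, prim, ← h1, h2, mul_add, inv_mul_cancel₀ hl]

lemma second_ineq {ℓ q G0 Gd : ℝ} (hℓ : 0 < ℓ) (h0 : 0 ≤ G0) (hd : 0 ≤ Gd) :
    Real.sqrt (ℓ⁻¹ * (G0 + ℓ ^ (2 * q) * Gd)) ≤
      max (ℓ ^ (-(1:ℝ) / 2)) (ℓ ^ (q - 1 / 2)) * Real.sqrt (G0 + Gd) := by
  set m := max (ℓ ^ (-(1:ℝ) / 2)) (ℓ ^ (q - 1 / 2)) with hm
  have p1 : 0 < ℓ ^ (-(1:ℝ) / 2) := Real.rpow_pos_of_pos hℓ _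
  have p2 : 0 < ℓ ^ (q - 1 / 2) := Real.rpow_pos_of_pos hℓ _
  have hm0 : 0 < m := lt_max_of_lt_left p1
  have e1 : ℓ⁻¹ = (ℓ ^ (-(1:ℝ) / 2)) ^ 2 := by
    rw [← Real.rpow_natCast, ← Real.rpow_mul hℓ.le, ← Real.rpow_neg_one]
    congr 1; push_cast; ring
  have e2 : ℓ⁻¹ * ℓ ^ (2 * q) = (ℓ ^ (q - 1 / 2)) ^ 2 := by
    rw [← Real.rpow_natCast, ← Real.rpow_mul hℓ.le, ← Real.rpow_neg_one, ← Real.rpow_add hℓ]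
    congr 1; push_cast; ring
  have l1 : ℓ⁻¹ ≤ m ^ 2 := by rw [e1]; gcongr; exact le_max_left _ _
  have l2 : ℓ⁻¹ * ℓ ^ (2 * q) ≤ m ^ 2 := by rw [e2]; gcongr; exact le_max_right _ _
  apply Real.sqrt_le_iff.mpr
  refine ⟨by positivity, ?_⟩
  rw [mul_pow, Real.sq_sqrt (by positivity), mul_add, mul_add, ← mul_assoc]
  gcongr

/-- Sobolev embedding with explicit dependence on the length
of the curve, for `r > 3/2` and `1/2 < q ≤ r`. -/
theorem invariant_sobolev_embedding (d : ℕ) (r q : ℝ) (hr : 3 / 2 < r)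
    (hq : 1 / 2 < q) (hqr : q ≤ r) :
    ∃ C : ℝ, 0 < C ∧
      ∀ c h : ℝ → Edim d, c ∈ SobImm d r → TangentH r h →
        ∀ ℓ : ℝ, 0 < ℓ → ℓ ≤ curveLen c →
          (⨆ θ : ℝ, ‖h θ‖) ≤
              C * Real.sqrt (ℓ⁻¹ * (G0Sq c h + ℓ ^ (2 * q) * GdotSq q c h)) ∧
          C * Real.sqrt (ℓ⁻¹ * (G0Sq c h + ℓ ^ (2 * q) * GdotSq q c h)) ≤
              C * max (ℓ ^ (-(1:ℝ) / 2)) (ℓ ^ (q - 1 / 2)) * Gnorm q c h := by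
  obtain ⟨A, hA0, hA⟩ := ker_sum hq
  refine ⟨Real.sqrt A, Real.sqrt_pos.mpr hA0, ?_⟩
  rintro c h hc ⟨hhc, hhp, -, hhs⟩ ℓ hℓ hℓl
  have hl : 0 < curveLen c := hℓ.trans_le hℓl
  have hcn : ∀ (f : ℝ → Edim d) n, 0 ≤ coeffNormSq f n := fun f n =>
    Finset.sum_nonneg fun i _ => by positivity
  have hom0 : 0 ≤ homSobSq q (h ∘ psiInv c) :=
    tsum_nonneg fun n => mul_nonneg (by positivity) (hcn _ n)
  have L20 : 0 ≤ L2Sq (h ∘ psiInv c) :=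
    intervalIntegral.integral_nonneg zero_le_one fun x _ => by positivity
  have hG0 : 0 ≤ G0Sq c h := mul_nonneg hl.le L20
  have hGd : 0 ≤ GdotSq q c h := mul_nonneg (by positivity) hom0
  refine ⟨?_, ?_⟩
  swap
  · rw [mul_assoc]
    refine mul_le_mul_of_nonneg_left ?_ (Real.sqrt_nonneg A)
    exact second_ineq hℓ hG0 hGd
  obtain ⟨dc, dp, dS⟩ := deriv_of_sob hr c hc
  have hhj : ∀ j, Continuous (fun x => ((h x j : ℝ) : ℂ)) := fun j =>
    Complex.continuous_ofReal.comp ((EuclideanSpace.proj (𝕜 := ℝ) j).continuous.comp hhc)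
  have hmain := fun j => comp_main hr (deriv c) dc dp dS hc.2.2.2 (fun x => ((h x j : ℝ) : ℂ)) (hhj j)
    (fun x => by simp only [hhp x]) (SS_of_summable h hhs j)
  apply ciSup_le
  intro θ
  have hpsi : psi c = prim (fun x => ‖deriv c x‖) := rfl
  have hinv : psiInv c = Function.invFun (prim (fun x => ‖deriv c x‖)) := rfl
  rcases isEmpty_or_nonempty (Fin d) with hemp | ⟨⟨j0⟩⟩
  · exfalso
    exact hc.2.2.2 0 (by ext j; exact hemp.elim j)
  obtain ⟨δ, L, R⟩ := (hmain j0).1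
  rw [← hinv] at R
  have hinv1 : ∀ x, psiInv c (x + 1) = psiInv c x + 1 := by
    intro x
    have h1 := prim_add_one (fun x => ‖deriv c x‖) dc.norm (fun x => by simp only [dp x]) hl.ne' (psiInv c x)
    rw [R.right] at h1
    rw [← h1, R.left]
  set f : ℝ → Edim d := h ∘ psiInv c with hf
  have hfc : Continuous f := hhc.comp R.cphi
  have hfjc : ∀ j, Continuous (fun x => ((f x j : ℝ) : ℂ)) := fun j => (hhj j).comp R.cphi
  have hfp : ∀ j, Function.Periodic (fun x => ((f x j : ℝ) : ℂ)) 1 := by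
    intro j x
    simp only [hf, Function.comp, hinv1, hhp _]
  have hfS : ∀ j, SS q (fun x => ((f x j : ℝ) : ℂ)) ≠ ⊤ := fun j =>
    ne_top_of_le_ne_top (hmain j).2 (SS_mono hqr _)
  have hb := fun j => scalar_bound hq hA0 hA _ (hfjc j) (hfp j) (hfS j)
  have hsum : homSobSq q f = ∑ j : Fin d, ∑' n : ℤ, |(n:ℝ)| ^ (2 * q) *
      ‖co (fun x => ((f x j : ℝ) : ℂ)) n‖ ^ 2 := by
    rw [← Summable.tsum_finsetSum (fun j _ => (hb j).1)]
    unfold homSobSq coeffNormSq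
    congr 1; ext n
    rw [Finset.mul_sum]
    rfl
  have hL2 : L2Sq f = ∑ j : Fin d, ∫ x in (0:ℝ)..1, ‖((f x j : ℝ) : ℂ)‖ ^ 2 := by
    rw [← intervalIntegral.integral_finsetSum]
    · unfold L2Sq
      congr 1; ext x
      rw [EuclideanSpace.norm_sq_eq]
      simp
    · intro j _
      have := hfjc j
      apply Continuous.intervalIntegrable
      fun_prop
  set ρ := ℓ / curveLen c with hρ
  have hρ0 : 0 < ρ := by positivity
  have hρ1 : ρ ≤ 1 := (div_le_one hl).mpr hℓl
  have hfin : ‖h θ‖ ^ 2 ≤ (A / ρ) * (L2Sq f + ρ ^ (2 * q) * homSobSq q f) := by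
    have e : h θ = f (prim (fun x => ‖deriv c x‖) θ) := by
      simp only [hf, Function.comp, R.left]
    rw [e, EuclideanSpace.norm_sq_eq, hsum, hL2, Finset.mul_sum, ← Finset.sum_add_distrib, Finset.mul_sum]
    apply Finset.sum_le_sum
    intro j _
    have := (hb j).2 ρ hρ0 hρ1 (prim (fun x => ‖deriv c x‖) θ)
    rwa [Complex.norm_real] at this
  have heq : (A / ρ) * (L2Sq f + ρ ^ (2 * q) * homSobSq q f) =
      A * (ℓ⁻¹ * (G0Sq c h + ℓ ^ (2 * q) * GdotSq q c h)) := by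
    unfold G0Sq GdotSq
    rw [← hf, hρ, Real.div_rpow hℓ.le hl.le, Real.rpow_sub hl, Real.rpow_one]
    have := (Real.rpow_pos_of_pos hl (2 * q)).ne'
    field_simp
  rw [heq] at hfin
  rw [← Real.sqrt_mul hA0.le]
  exact Real.le_sqrt_of_sq_le hfin


end
end
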